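/- Let d ≥ 1 and let H be a d-regular strictly 2-balanced graph with v(H) ≥ 4d. Then there exists a constant c > 0 such that if p = p(n) ≤ c·n^{-1/m_2(H)}, the probability that G(n,p) has the anti-Ramsey property for H tends to 0 as n → ∞. -/

import Mathlib

open SimpleGraph Filter

/-- `f` is the vertex map of a copy of `H` inside `G`. -/
def GraphCopy {V W : Type*} (H : SimpleGraph W) (G : SimpleGraph V) (f : W ↪ V) : Prop :=
  ∀ ⦃x y : W⦄, H.Adj x y → G.Adj (f x) (f y)

/-- The colouring `χ` admits a monochromatic copy of `H` in `G`. -/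
def HasMonoCopy {V W β : Type*} (H : SimpleGraph W) (G : SimpleGraph V)
    (χ : Sym2 V → β) : Prop :=
  ∃ f : W ↪ V, GraphCopy H G f ∧
    ∀ e ∈ H.edgeSet, ∀ e' ∈ H.edgeSet, χ (Sym2.map (⇑f) e) = χ (Sym2.map (⇑f) e')

/-- The colouring `χ` admits a rainbow copy of `H` in `G`. -/
def HasRainbowCopy {V W β : Type*} (H : SimpleGraph W) (G : SimpleGraph V)
    (χ : Sym2 V → β) : Prop :=
  ∃ f : W ↪ V, GraphCopy H G f ∧
    ∀ e ∈ H.edgeSet, ∀ e' ∈ H.edgeSet, e ≠ e' → χ (Sym2.map (⇑f) e) ≠ χ (Sym2.map (⇑f) e')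

/-- `G` has the constrained Ramsey property for `(H₁, H₂)`. -/
def ConstrainedRamsey {V W₁ W₂ : Type*} (G : SimpleGraph V)
    (H₁ : SimpleGraph W₁) (H₂ : SimpleGraph W₂) : Prop :=
  ∀ (β : Type) (χ : Sym2 V → β), HasMonoCopy H₁ G χ ∨ HasRainbowCopy H₂ G χ

/-- `χ` is a proper edge-colouring of `G`. -/
def ProperEdgeColoring {V β : Type*} (G : SimpleGraph V) (χ : Sym2 V → β) : Prop :=
  ∀ e ∈ G.edgeSet, ∀ e' ∈ G.edgeSet, e ≠ e' → (∃ v, v ∈ e ∧ v ∈ e') → χ e ≠ χ e'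

/-- `G` has the anti-Ramsey property for `H`. -/
def AntiRamsey {V W : Type*} (G : SimpleGraph V) (H : SimpleGraph W) : Prop :=
  ∀ (β : Type) (χ : Sym2 V → β), ProperEdgeColoring G χ → HasRainbowCopy H G χ

/-- The value `d₂` computed from the number of edges `e` and vertices `v`. -/
noncomputable def d2val (e v : ℕ) : ℝ :=
  if 1 ≤ e ∧ 3 ≤ v then ((e : ℝ) - 1) / ((v : ℝ) - 2)
  else if e = 1 ∧ v = 2 then 1 / 2
  else 0

/-- `m(G)`: the maximum of `e(J)/v(J)` over subgraphs `J` of `G` with at least one vertex. -/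
noncomputable def maxDensity {V : Type*} (G : SimpleGraph V) : ℝ :=
  sSup {x : ℝ | ∃ J : G.Subgraph, J.verts.Nonempty ∧
    x = (J.edgeSet.ncard : ℝ) / (J.verts.ncard : ℝ)}

/-- `m₂(G)`: the maximum of `d₂(J)` over subgraphs `J` of `G`. -/
noncomputable def twoDensity {V : Type*} (G : SimpleGraph V) : ℝ :=
  sSup {x : ℝ | ∃ J : G.Subgraph, x = d2val J.edgeSet.ncard J.verts.ncard}

/-- `G` is strictly 2-balanced. -/
def StrictlyTwoBalanced {V : Type*} (G : SimpleGraph V) : Prop :=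
  ∀ J : G.Subgraph, J ≠ ⊤ →
    d2val J.edgeSet.ncard J.verts.ncard < d2val G.edgeSet.ncard (Nat.card V)

/-- The star `K_{1,k}` with centre `0`. -/
def starGraph (k : ℕ) : SimpleGraph (Fin (k + 1)) :=
  SimpleGraph.fromRel (fun i _ => i = 0)

/-- The minimum degree `δ(G)`. -/
noncomputable def minDeg {V : Type*} (G : SimpleGraph V) : ℕ :=
  sInf {d : ℕ | ∃ v : V, d = (G.neighborSet v).ncard}

noncomputable instance (n : ℕ) : Fintype (SimpleGraph (Fin n)) :=
  Fintype.ofInjective (fun G : SimpleGraph (Fin n) => G.edgeSet)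
    fun _ _ h => SimpleGraph.edgeSet_inj.mp h

open Classical in
/-- The probability that `G(n,p)` satisfies the property `P`. -/
noncomputable def grProb (n : ℕ) (p : ℝ) (P : SimpleGraph (Fin n) → Prop) : ℝ :=
  ∑ G : SimpleGraph (Fin n),
    if P G then p ^ G.edgeSet.ncard * (1 - p) ^ (n.choose 2 - G.edgeSet.ncard) else 0

/-- `s` is the vertex set of a triangle of `T`. -/
def IsTriangleSet {V : Type*} (T : SimpleGraph V) (s : Set V) : Prop :=
  ∃ x y z : V, T.Adj x y ∧ T.Adj x z ∧ T.Adj y z ∧ s = {x, y, z}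

/-- `T` is triangle-connected. -/
def TriangleConnected {V : Type*} (T : SimpleGraph V) : Prop :=
  (∀ v : V, ∃ w, T.Adj v w) ∧
  (∀ u v : V, T.Adj u v → ∃ w, T.Adj u w ∧ T.Adj v w) ∧
  (∀ s t : Set V, IsTriangleSet T s → IsTriangleSet T t →
    Relation.ReflTransGen
      (fun x y : Set V => IsTriangleSet T x ∧ IsTriangleSet T y ∧ (x ∩ y).ncard = 2) s t)

/-- A triangle sequence `T₀, …, T_ℓ` in `T`, together with the chosen vertices `v i`
and base edges `a i`–`b i`. -/
structure TriangleSeq {V : Type*} (T : SimpleGraph V) (ℓ : ℕ) where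
  G : ℕ → T.Subgraph
  v : ℕ → V
  a : ℕ → V
  b : ℕ → V
  init : ∃ x y z : V, ∃ (hxy : T.Adj x y) (hxz : T.Adj x z) (hyz : T.Adj y z),
    G 0 = T.subgraphOfAdj hxy ⊔ T.subgraphOfAdj hxz ⊔ T.subgraphOfAdj hyz
  newVert : ∀ i, 1 ≤ i → i ≤ ℓ → v i ∉ (G (i - 1)).verts
  baseEdge : ∀ i, 1 ≤ i → i ≤ ℓ →
    (G (i - 1)).Adj (a i) (b i) ∧ T.Adj (v i) (a i) ∧ T.Adj (v i) (b i)
  vertsEq : ∀ i, 1 ≤ i → i ≤ ℓ → (G i).verts = (G (i - 1)).verts ∪ {v i}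
  adjEq : ∀ i, 1 ≤ i → i ≤ ℓ → ∀ x y : V, (G i).Adj x y ↔
    ((G (i - 1)).Adj x y ∨ (x = v i ∧ y ∈ (G (i - 1)).verts ∧ T.Adj x y)
      ∨ (y = v i ∧ x ∈ (G (i - 1)).verts ∧ T.Adj x y))

/-- `deg(v_i, T_{i-1})`: the number of neighbours of `v i` (in `T`) inside `T_{i-1}`. -/
noncomputable def TriangleSeq.deg {V : Type*} {T : SimpleGraph V} {ℓ : ℕ}
    (s : TriangleSeq T ℓ) (i : ℕ) : ℕ :=
  ((s.G (i - 1)).verts ∩ T.neighborSet (s.v i)).ncard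

/-- `r(T₀, …, T_ℓ) = Σ_{i ∈ [ℓ]} (deg(v_i, T_{i-1}) − 2)`. -/
noncomputable def TriangleSeq.r {V : Type*} {T : SimpleGraph V} {ℓ : ℕ}
    (s : TriangleSeq T ℓ) : ℤ :=
  ∑ i ∈ Finset.Icc 1 ℓ, ((s.deg i : ℤ) - 2)

/-- Step `i` is regular. -/
def TriangleSeq.Regular {V : Type*} {T : SimpleGraph V} {ℓ : ℕ}
    (s : TriangleSeq T ℓ) (i : ℕ) : Prop :=
  s.deg i = 2

/-- A `ρ`-minimal triangle sequence. -/
def RhoMinimal {V : Type*} {T : SimpleGraph V} {ℓ : ℕ} (ρ : ℕ)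
    (s : TriangleSeq T ℓ) : Prop :=
  (ρ : ℤ) ≤ s.r ∧ ∀ (ℓ' : ℕ) (s' : TriangleSeq T ℓ'), (ρ : ℤ) ≤ s'.r → ¬ s'.G ℓ' < s.G ℓ


section AntiRamseyZero
open scoped Classical

/-- The edge set of a graph on a finite vertex type, as a finset. -/
noncomputable def edgeFin {V : Type*} [Fintype V] (H : SimpleGraph V) : Finset (Sym2 V) :=
  Finset.univ.filter (· ∈ H.edgeSet)

theorem mem_edgeFin {V : Type*} [Fintype V] {H : SimpleGraph V} {e : Sym2 V} :
    e ∈ edgeFin H ↔ e ∈ H.edgeSet := by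
  simp [edgeFin]

theorem coe_edgeFin {V : Type*} [Fintype V] (H : SimpleGraph V) :
    (edgeFin H : Set (Sym2 V)) = H.edgeSet := by
  ext e
  simp [mem_edgeFin]

theorem ncard_edgeSet_eq {V : Type*} [Fintype V] (H : SimpleGraph V) :
    H.edgeSet.ncard = (edgeFin H).card := by
  rw [← coe_edgeFin, Set.ncard_coe_finset]

theorem two_mul_card_edgeFin {V : Type*} [Fintype V] {H : SimpleGraph V} {d : ℕ}
    (hreg : ∀ v : V, (H.neighborSet v).ncard = d) :
    2 * (edgeFin H).card = d * Fintype.card V := by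
  have h := H.sum_degrees_eq_twice_card_edges
  have h1 : ∀ v, H.degree v = d := fun v => by
    rw [← hreg v, ← SimpleGraph.card_neighborSet_eq_degree, Set.ncard_eq_toFinset_card',
      Set.toFinset_card]
  have h2 : edgeFin H = H.edgeFinset := by
    ext e
    simp [mem_edgeFin]
  rw [h2, ← h]
  simp [h1, mul_comm]

/-- The subgraph with vertex set `S` and edge set `T`. -/
def subgraphOfFinsets {V : Type*} [Fintype V] (H : SimpleGraph V) (S : Finset V)
    (T : Finset (Sym2 V)) (hT : T ⊆ edgeFin H) (hTS : ∀ e ∈ T, ∀ z ∈ e, z ∈ S) :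
    H.Subgraph where
  verts := S
  Adj a b := s(a, b) ∈ T
  adj_sub h := by simpa [mem_edgeFin] using hT h
  edge_vert h := hTS _ h _ (by simp)
  symm := ⟨fun a b h => by rwa [Sym2.eq_swap]⟩

theorem edgeSet_subgraphOfFinsets {V : Type*} [Fintype V] (H : SimpleGraph V) (S : Finset V)
    (T : Finset (Sym2 V)) (hT : T ⊆ edgeFin H) (hTS : ∀ e ∈ T, ∀ z ∈ e, z ∈ S) :
    (subgraphOfFinsets H S T hT hTS).edgeSet = T := by
  ext e
  induction e with
  | h a b => simp [subgraphOfFinsets]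

theorem StrictlyTwoBalanced.sub_mul_lt {V : Type*} [Fintype V] {H : SimpleGraph V}
    (hbal : StrictlyTwoBalanced H) (hv : 3 ≤ Fintype.card V) (he : 1 ≤ (edgeFin H).card)
    {S : Finset V} {T : Finset (Sym2 V)} (hT : T ⊆ edgeFin H)
    (hTS : ∀ e ∈ T, ∀ z ∈ e, z ∈ S) (hne : S ≠ Finset.univ ∨ T ≠ edgeFin H)
    (hS : 3 ≤ S.card) (hT1 : 1 ≤ T.card) :
    ((Fintype.card V : ℤ) - 2) * (T.card - 1) < ((edgeFin H).card - 1) * (S.card - 2) := by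
  have h := hbal (subgraphOfFinsets H S T hT hTS) (by
    intro h
    rcases hne with h1 | h1
    · apply h1
      have := congrArg Subgraph.verts h
      simpa [subgraphOfFinsets] using this
    · apply h1
      have := congrArg Subgraph.edgeSet h
      rw [edgeSet_subgraphOfFinsets, Subgraph.edgeSet_top, ← coe_edgeFin] at this
      exact_mod_cast this)
  rw [edgeSet_subgraphOfFinsets, ncard_edgeSet_eq, Set.ncard_coe_finset, Nat.card_eq_fintype_card]
    at h
  have h2 : (subgraphOfFinsets H S T hT hTS).verts.ncard = S.card := by
    simp [subgraphOfFinsets]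
  rw [h2, d2val, d2val, if_pos ⟨hT1, hS⟩, if_pos ⟨he, hv⟩] at h
  have hS' : (3 : ℝ) ≤ S.card := by exact_mod_cast hS
  have hv' : (3 : ℝ) ≤ Fintype.card V := by exact_mod_cast hv
  rw [div_lt_div_iff₀ (by linarith) (by linarith)] at h
  have h3 : ((Fintype.card V : ℝ) - 2) * (T.card - 1) < ((edgeFin H).card - 1) * (S.card - 2) := by
    linarith
  exact_mod_cast h3

theorem twoDensity_eq {V : Type*} [Fintype V] {H : SimpleGraph V}
    (hbal : StrictlyTwoBalanced H) (hv : 3 ≤ Fintype.card V) (he : 1 ≤ (edgeFin H).card) :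
    twoDensity H = (((edgeFin H).card : ℝ) - 1) / ((Fintype.card V : ℝ) - 2) := by
  have h0 : d2val (edgeFin H).card (Fintype.card V) =
      (((edgeFin H).card : ℝ) - 1) / ((Fintype.card V : ℝ) - 2) := by
    rw [d2val, if_pos ⟨he, hv⟩]
  rw [← h0, twoDensity]
  apply IsGreatest.csSup_eq
  constructor
  · refine ⟨⊤, ?_⟩
    rw [Subgraph.edgeSet_top, ncard_edgeSet_eq]
    simp [Set.ncard_univ]
  · rintro x ⟨J, rfl⟩
    by_cases hJ : J = ⊤
    · subst hJ
      rw [Subgraph.edgeSet_top, ncard_edgeSet_eq]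
      simp [Set.ncard_univ]
    · have := hbal J hJ
      rw [ncard_edgeSet_eq, Nat.card_eq_fintype_card] at this
      exact this.le

theorem StrictlyTwoBalanced.two_le_degree {V : Type*} [Fintype V] {H : SimpleGraph V} {d : ℕ}
    (hbal : StrictlyTwoBalanced H) (hreg : ∀ v : V, (H.neighborSet v).ncard = d)
    (hd : 1 ≤ d) (hv : 3 ≤ Fintype.card V) : 2 ≤ d := by
  by_contra hd2
  obtain rfl : d = 1 := by omega
  have h2e := two_mul_card_edgeFin hreg
  obtain ⟨x⟩ : Nonempty V := Fintype.card_pos_iff.mp (by omega)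
  have hx : (H.neighborSet x).Nonempty := by
    rw [← Set.ncard_pos, hreg]; norm_num
  obtain ⟨y, hy⟩ := hx
  have hy : H.Adj x y := hy
  have h := hbal (H.subgraphOfAdj hy) (by
    intro h
    have := congrArg Subgraph.verts h
    simp only [subgraphOfAdj_verts, Subgraph.verts_top] at this
    have h3 := congrArg Set.ncard this
    rw [Set.ncard_pair hy.ne, Set.ncard_univ, Nat.card_eq_fintype_card] at h3
    omega)
  rw [ncard_edgeSet_eq, Nat.card_eq_fintype_card, SimpleGraph.edgeSet_subgraphOfAdj,
    Set.ncard_singleton, subgraphOfAdj_verts, Set.ncard_pair hy.ne, d2val, d2val,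
    if_neg (by norm_num), if_pos (by norm_num), if_pos (by omega)] at h
  have hv' : (3 : ℝ) ≤ Fintype.card V := by exact_mod_cast hv
  rw [lt_div_iff₀ (by linarith)] at h
  have : (2 : ℝ) * (edgeFin H).card = 1 * Fintype.card V := by exact_mod_cast h2e
  linarith

/-- Two adjacent vertices do not separate a strictly 2-balanced graph. -/
theorem StrictlyTwoBalanced.eq_of_closed {V : Type*} [Fintype V] {H : SimpleGraph V}
    (hbal : StrictlyTwoBalanced H) {x y : V} (hxy : H.Adj x y) {U : Finset V}
    (hU : U.Nonempty) (hx : x ∉ U) (hy : y ∉ U)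
    (hcl : ∀ a ∈ U, ∀ b, H.Adj a b → b ≠ x → b ≠ y → b ∈ U) :
    ∀ z, z ≠ x → z ≠ y → z ∈ U := by
  intro z hzx hzy
  by_contra hz
  have hxyne := hxy.ne
  set X : Finset V := insert x (insert y U) with hX
  set Y : Finset V := Uᶜ with hY
  set TX := (edgeFin H).filter (fun e => ∀ z ∈ e, z ∈ X) with hTX
  set TY := (edgeFin H).filter (fun e => ∀ z ∈ e, z ∈ Y) with hTY
  have hXc : X.card = U.card + 2 := by
    rw [hX, Finset.card_insert_of_notMem (by simp [hx, hxyne]), Finset.card_insert_of_notMem hy]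
  have hYc : Y.card + U.card = Fintype.card V := by
    rw [hY, add_comm, Finset.card_add_card_compl]
  have hUc := hU.card_pos
  have hY3 : 3 ≤ Y.card := by
    have : ({x, y, z} : Finset V) ⊆ Y := by
      intro w hw
      simp only [Finset.mem_insert, Finset.mem_singleton] at hw
      rcases hw with rfl | rfl | rfl <;> simpa [hY]
    refine le_trans ?_ (Finset.card_le_card this)
    rw [Finset.card_eq_three.mpr ⟨x, y, z, hxyne, hzx.symm, hzy.symm, rfl⟩]
  have hxyX : s(x, y) ∈ TX := by simp [hTX, mem_edgeFin, hxy, hX]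
  have hxyY : s(x, y) ∈ TY := by simp [hTY, mem_edgeFin, hxy, hx, hy, hY]
  have hun : TX ∪ TY = edgeFin H := by
    apply Finset.Subset.antisymm
    · exact Finset.union_subset (Finset.filter_subset _ _) (Finset.filter_subset _ _)
    · intro e he
      induction e with
      | h a b =>
        have hab : H.Adj a b := mem_edgeFin.mp he
        have h1 := hcl a
        have h2 := fun hb => hcl b hb a hab.symm
        simp only [hTX, hTY, Finset.mem_union, Finset.mem_filter, he, true_and, Sym2.mem_iff,
          forall_eq_or_imp, forall_eq, hX, hY, Finset.mem_insert, Finset.mem_compl]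
        have h1' := fun ha => h1 ha b hab
        clear h1
        tauto
  have hin : 1 ≤ (TX ∩ TY).card := Finset.card_pos.mpr ⟨_, Finset.mem_inter.mpr ⟨hxyX, hxyY⟩⟩
  have hsum := Finset.card_union_add_card_inter TX TY
  rw [hun] at hsum
  have hv3 : 3 ≤ Fintype.card V := by omega
  have he1 : 1 ≤ (edgeFin H).card := Finset.card_pos.mpr ⟨s(x, y), mem_edgeFin.mpr hxy⟩
  have b1 := hbal.sub_mul_lt hv3 he1 (S := X) (T := TX) (Finset.filter_subset _ _)
    (fun e he => (Finset.mem_filter.mp he).2) (Or.inl fun h => by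
      have := Finset.mem_univ z
      rw [← h] at this
      simp [hX, hzx, hzy, hz] at this) (by omega) (Finset.card_pos.mpr ⟨_, hxyX⟩)
  have b2 := hbal.sub_mul_lt hv3 he1 (S := Y) (T := TY) (Finset.filter_subset _ _)
    (fun e he => (Finset.mem_filter.mp he).2) (Or.inl fun h => by
      obtain ⟨u, hu⟩ := hU
      have := Finset.mem_univ u
      rw [← h] at this
      simp [hY, hu] at this) (by omega) (Finset.card_pos.mpr ⟨_, hxyY⟩)
  have hXz : (X.card : ℤ) = U.card + 2 := by exact_mod_cast hXc
  have hYz : (Y.card : ℤ) = Fintype.card V - U.card := by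
    rw [← hYc]; push_cast; ring
  rw [hXz] at b1
  rw [hYz] at b2
  have hv' : (3 : ℤ) ≤ Fintype.card V := by exact_mod_cast hv3
  have hs : ((edgeFin H).card : ℤ) + 1 ≤ TX.card + TY.card := by
    have : (edgeFin H).card + 1 ≤ TX.card + TY.card := by omega
    exact_mod_cast this
  nlinarith [mul_nonneg (show (0 : ℤ) ≤ Fintype.card V - 2 by linarith)
    (show (0 : ℤ) ≤ TX.card + TY.card - (edgeFin H).card - 1 by linarith)]

theorem StrictlyTwoBalanced.exists_disjoint_nbrs {V : Type*} [Fintype V] {H : SimpleGraph V}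
    {d : ℕ} (hbal : StrictlyTwoBalanced H) (hreg : ∀ v : V, (H.neighborSet v).ncard = d)
    (hd : 2 ≤ d) (hv : 4 ≤ Fintype.card V) {x y : V} (hxy : H.Adj x y) :
    ∃ x' y', H.Adj x x' ∧ H.Adj y y' ∧ x' ≠ y ∧ y' ≠ x ∧ x' ≠ y' := by
  have key : ∀ {a b : V}, H.Adj a b → ∃ a', H.Adj a a' ∧ a' ≠ b := fun {a b} hab => by
    obtain ⟨a', ha', hne⟩ := Set.exists_ne_of_one_lt_ncard (s := H.neighborSet a)
      (by rw [hreg]; omega) b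
    exact ⟨a', ha', hne⟩
  by_contra! hcon
  obtain ⟨x', hx', hx'y⟩ := key hxy
  obtain ⟨y', hy', hy'x⟩ := key hxy.symm
  have h0 := hcon x' y' hx' hy' hx'y hy'x
  subst h0
  have hNx : H.neighborSet x = {y, x'} := by
    ext w
    simp only [mem_neighborSet, Set.mem_insert_iff, Set.mem_singleton_iff]
    constructor
    · intro hw
      by_cases hwy : w = y
      · exact Or.inl hwy
      · exact Or.inr (hcon w x' hw hy' hwy hy'x)
    · rintro (rfl | rfl)
      · exact hxy
      · exact hx'
  have hd2 : d = 2 := by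
    rw [← hreg x, hNx, Set.ncard_pair hx'y.symm]
  have hNz : ({x, y} : Set V) = H.neighborSet x' := by
    refine Set.eq_of_subset_of_ncard_le ?_ ?_ (Set.toFinite _)
    · rintro w (rfl | rfl)
      · exact hx'.symm
      · exact hy'.symm
    · rw [hreg, Set.ncard_pair hxy.ne, hd2]
  have hall := hbal.eq_of_closed hxy (U := {x'}) (by simp) (by simpa using hx'.ne)
    (by simpa using hx'y.symm) (by
      intro a ha b hab hbx hby
      rw [Finset.mem_singleton] at ha
      subst ha
      have : b ∈ ({x, y} : Set V) := by rw [hNz]; exact hab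
      simp [hbx, hby] at this)
  have : (Finset.univ : Finset V) ⊆ {x, y, x'} := by
    intro z _
    have := hall z
    simp only [Finset.mem_insert, Finset.mem_singleton] at this ⊢
    tauto
  have := (Finset.card_le_card this).trans Finset.card_le_three
  rw [Finset.card_univ] at this
  omega

/-- `φ` is an injective homomorphism from `H` to `G`. -/
def IsCopyMap {V U : Type*} (H : SimpleGraph V) (G : SimpleGraph U) (φ : V → U) : Prop :=
  Function.Injective φ ∧ ∀ ⦃x y : V⦄, H.Adj x y → G.Adj (φ x) (φ y)

/-- The image of the edge set of `H` under a vertex map. -/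
noncomputable def edgeImage {V U : Type*} [Fintype V] (H : SimpleGraph V) (φ : V → U) :
    Finset (Sym2 U) :=
  (edgeFin H).image (Sym2.map φ)

theorem mem_edgeImage {V U : Type*} [Fintype V] {H : SimpleGraph V} {φ : V → U} {e : Sym2 U} :
    e ∈ edgeImage H φ ↔ ∃ a b, H.Adj a b ∧ s(φ a, φ b) = e := by
  simp only [edgeImage, Finset.mem_image, mem_edgeFin]
  constructor
  · rintro ⟨f, hf, rfl⟩
    induction f with
    | h a b => exact ⟨a, b, hf, by simp⟩
  · rintro ⟨a, b, hab, rfl⟩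
    exact ⟨s(a, b), hab, by simp⟩

theorem mk_mem_edgeImage {V U : Type*} [Fintype V] {H : SimpleGraph V} {φ : V → U} {a b : V}
    (h : H.Adj a b) : s(φ a, φ b) ∈ edgeImage H φ :=
  mem_edgeImage.mpr ⟨a, b, h, rfl⟩

theorem IsCopyMap.edge_mem {V U : Type*} [Fintype V] {H : SimpleGraph V} {G : SimpleGraph U}
    {φ : V → U} (hφ : IsCopyMap H G φ) {e : Sym2 U} (he : e ∈ edgeImage H φ) :
    e ∈ G.edgeSet := by
  obtain ⟨a, b, hab, rfl⟩ := mem_edgeImage.mp he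
  exact hφ.2 hab

theorem IsCopyMap.exists_edge {V U : Type*} [Fintype V] {H : SimpleGraph V} {G : SimpleGraph U}
    {φ : V → U} (hφ : IsCopyMap H G φ) {z : V} {w : U} (he : s(φ z, w) ∈ edgeImage H φ) :
    ∃ z', H.Adj z z' ∧ φ z' = w := by
  obtain ⟨a, b, hab, h⟩ := mem_edgeImage.mp he
  rw [Sym2.eq_iff] at h
  rcases h with ⟨h1, h2⟩ | ⟨h1, h2⟩
  · exact ⟨b, hφ.1 h1 ▸ hab, h2⟩
  · exact ⟨a, hφ.1 h2 ▸ hab.symm, h1⟩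

/-- In a minimal anti-Ramsey graph, two disjoint edges are separated by some copy of `H`. -/
theorem exists_copy_separating {V U : Type*} [Fintype V] {H : SimpleGraph V} {G : SimpleGraph U}
    (hmin : Minimal (fun G : SimpleGraph U => AntiRamsey G H) G) {e f : Sym2 U}
    (he : e ∈ G.edgeSet) (hdis : ∀ v, v ∈ e → v ∉ f) :
    ∃ φ, IsCopyMap H G φ ∧ ¬ (e ∈ edgeImage H φ ↔ f ∈ edgeImage H φ) := by
  have hlt : G.deleteEdges {e, f} < G := by
    refine lt_of_le_of_ne (G.deleteEdges_le _) fun h => ?_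
    rw [← h, edgeSet_deleteEdges] at he
    exact he.2 (by simp)
  have hnot := hmin.not_prop_of_lt hlt
  simp only [AntiRamsey, not_forall] at hnot
  obtain ⟨β, χ, hχ, hno⟩ := hnot
  set χ' : Sym2 U → Option β := fun g => if g = e ∨ g = f then none else some (χ g) with hχ'
  have hprop : ProperEdgeColoring G χ' := by
    rintro g hg g' hg' hne ⟨v, hv, hv'⟩
    have hev := hdis v
    by_cases h1 : g = e ∨ g = f <;> by_cases h2 : g' = e ∨ g' = f
    · exfalso
      rcases h1 with rfl | rfl <;> rcases h2 with rfl | rfl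
      · exact hne rfl
      · exact hev hv hv'
      · exact hev hv' hv
      · exact hne rfl
    · simp [hχ', h1, h2]
    · simp [hχ', h1, h2]
    · simp only [hχ', h1, h2, if_false]
      intro h
      refine hχ g ?_ g' ?_ hne ⟨v, hv, hv'⟩ (Option.some.inj h)
      · rw [edgeSet_deleteEdges]; exact ⟨hg, by simpa using h1⟩
      · rw [edgeSet_deleteEdges]; exact ⟨hg', by simpa using h2⟩
  obtain ⟨φ, hφ, hrb⟩ := hmin.prop _ χ' hprop
  refine ⟨φ, ⟨φ.injective, hφ⟩, fun hiff => ?_⟩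
  by_cases hm : e ∈ edgeImage H φ
  · have hm' := hiff.mp hm
    simp only [edgeImage, Finset.mem_image, mem_edgeFin] at hm hm'
    obtain ⟨g, hg, hge⟩ := hm
    obtain ⟨g', hg', hge'⟩ := hm'
    refine hrb g hg g' hg' ?_ ?_
    · rintro rfl
      induction e with
      | h a b => exact hdis a (by simp) (by rw [← hge', hge]; simp)
    · simp [hχ', hge, hge']
  · have hm' := fun h => hm (hiff.mpr h)
    have hnone : ∀ g ∈ H.edgeSet, ¬ (Sym2.map φ g = e ∨ Sym2.map φ g = f) := by
      intro g hg h
      simp only [edgeImage, Finset.mem_image, mem_edgeFin] at hm hm'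
      rcases h with h | h
      · exact hm ⟨g, hg, h⟩
      · exact hm' ⟨g, hg, h⟩
    refine hno ⟨φ, ?_, ?_⟩
    · intro x y hxy
      rw [deleteEdges_adj]
      exact ⟨hφ hxy, by simpa using hnone s(x, y) hxy⟩
    · intro g hg g' hg' hne h
      refine hrb g hg g' hg' hne ?_
      simp [hχ', hnone g hg, hnone g' hg', h]

theorem exists_adj_of_mem_of_ncard_le {V U : Type*} [Fintype V] [Finite U] {H : SimpleGraph V}
    {G : SimpleGraph U} {d : ℕ} (hreg : ∀ v : V, (H.neighborSet v).ncard = d) {ψ : V → U}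
    (hψ : IsCopyMap H G ψ) {E : Finset (Sym2 U)} (hE : edgeImage H ψ ⊆ E) {t : V}
    (hdeg : {w | s(ψ t, w) ∈ E}.ncard ≤ d) {w : U} (hw : s(ψ t, w) ∈ E) :
    ∃ t', H.Adj t t' ∧ ψ t' = w := by
  have h : ψ '' (H.neighborSet t) = {w | s(ψ t, w) ∈ E} := by
    refine Set.eq_of_subset_of_ncard_le ?_ ?_ (Set.toFinite _)
    · rintro _ ⟨t', ht', rfl⟩
      exact hE (mk_mem_edgeImage ht')
    · rwa [Set.ncard_image_of_injective _ hψ.1, hreg]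
  have hw' : w ∈ ψ '' (H.neighborSet t) := by rw [h]; exact hw
  exact hw'

/-- Some copy of `H` in `G` shares an edge inside `O` with `E` but is not contained in `E`. -/
def Extendable {V U : Type*} [Fintype V] (H : SimpleGraph V) (G : SimpleGraph U)
    (E : Finset (Sym2 U)) (O : Finset U) : Prop :=
  ∃ ψ : V → U, IsCopyMap H G ψ ∧
    (∃ a b, H.Adj a b ∧ s(ψ a, ψ b) ∈ E ∧ ψ a ∈ O ∧ ψ b ∈ O) ∧ ¬ edgeImage H ψ ⊆ E

theorem edgeImage_subset_of_glued {V U : Type*} [Fintype V] [Finite U] {H : SimpleGraph V}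
    {G : SimpleGraph U} {d : ℕ} (hbal : StrictlyTwoBalanced H)
    (hreg : ∀ v : V, (H.neighborSet v).ncard = d) {W : Finset U} {E : Finset (Sym2 U)}
    (hE : ∀ e ∈ E, ∀ z ∈ e, z ∈ W) {φ ψ : V → U} (hφ : IsCopyMap H G φ) (hψ : IsCopyMap H G ψ)
    {x y : V} (hxy : H.Adj x y) (hout : ∀ z, z ≠ x → z ≠ y → φ z ∉ W)
    (hsub : edgeImage H ψ ⊆ E ∪ edgeImage H φ) {p q : V} (hpx : p ≠ x) (hpy : p ≠ y)
    (hpq : s(φ p, φ q) ∈ edgeImage H ψ) {p' q' : V} (hp'x : p' ≠ x) (hp'y : p' ≠ y)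
    (hpq' : H.Adj p' q') : s(φ p', φ q') ∈ edgeImage H ψ := by
  have key : ∀ z, z ≠ x → z ≠ y → φ z ∈ Set.range ψ → ∀ z', H.Adj z z' →
      φ z' ∈ Set.range ψ ∧ s(φ z, φ z') ∈ edgeImage H ψ := by
    rintro z hzx hzy ⟨t, ht⟩ z' hzz'
    have hnb : {w | s(ψ t, w) ∈ E ∪ edgeImage H φ} ⊆ φ '' (H.neighborSet z) := by
      intro w hw
      rw [Set.mem_ofPred_eq, Finset.mem_union, ht] at hw
      rcases hw with hw | hw
      · exact absurd (hE _ hw (φ z) (by simp)) (hout z hzx hzy)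
      · exact hφ.exists_edge hw
    obtain ⟨t', ht', h⟩ := exists_adj_of_mem_of_ncard_le hreg hψ hsub (t := t)
      ((Set.ncard_le_ncard hnb (Set.toFinite _)).trans
        (by rw [Set.ncard_image_of_injective _ hφ.1, hreg])) (w := φ z')
      (by rw [ht]; exact Finset.mem_union_right _ (mk_mem_edgeImage hzz'))
    exact ⟨⟨t', h⟩, by rw [← h, ← ht]; exact mk_mem_edgeImage ht'⟩
  have hall := hbal.eq_of_closed hxy
    (U := Finset.univ.filter (fun z => z ≠ x ∧ z ≠ y ∧ φ z ∈ Set.range ψ))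
    ⟨p, by
      obtain ⟨a, b, -, h⟩ := mem_edgeImage.mp hpq
      have hp : φ p ∈ s(ψ a, ψ b) := by rw [h]; simp
      rw [Sym2.mem_iff] at hp
      simp only [Finset.mem_filter, Finset.mem_univ, true_and]
      refine ⟨hpx, hpy, ?_⟩
      rcases hp with hp | hp
      · exact ⟨a, hp.symm⟩
      · exact ⟨b, hp.symm⟩⟩ (by simp) (by simp) (by
      intro a ha b hab hbx hby
      simp only [Finset.mem_filter, Finset.mem_univ, true_and] at ha ⊢
      exact ⟨hbx, hby, (key a ha.1 ha.2.1 ha.2.2 b hab).1⟩)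
  have hp' := hall p' hp'x hp'y
  simp only [Finset.mem_filter, Finset.mem_univ, true_and] at hp'
  exact (key p' hp'x hp'y hp'.2.2 q' hpq').2

/-- A copy glued along a single edge in a minimal anti-Ramsey graph can be extended further. -/
theorem extendable_of_glued {V U : Type*} [Fintype V] [Finite U] {H : SimpleGraph V}
    {G : SimpleGraph U} {d : ℕ} (hbal : StrictlyTwoBalanced H)
    (hreg : ∀ v : V, (H.neighborSet v).ncard = d) (hd : 2 ≤ d) (hv : 4 ≤ Fintype.card V)
    (hmin : Minimal (fun G : SimpleGraph U => AntiRamsey G H) G)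
    {W : Finset U} {E : Finset (Sym2 U)}
    (hE : ∀ e ∈ E, ∀ z ∈ e, z ∈ W) {φ : V → U} (hφ : IsCopyMap H G φ)
    {x y : V} (hxy : H.Adj x y) (hout : ∀ z, z ≠ x → z ≠ y → φ z ∉ W) :
    Extendable H G (E ∪ edgeImage H φ) (Finset.univ.image φ) := by
  obtain ⟨x', y', hx', hy', hx'y, hy'x, hne⟩ := hbal.exists_disjoint_nbrs hreg hd hv hxy
  obtain ⟨ψ, hψ, hsep⟩ := exists_copy_separating hmin (e := s(φ x', φ x)) (f := s(φ y', φ y))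
    (hφ.2 hx'.symm) (by
      intro v hv hv'
      rw [Sym2.mem_iff] at hv hv'
      have h1 := hφ.1.ne hx'y
      have h2 := hφ.1.ne hy'x
      have h3 := hφ.1.ne hne
      have h4 := hφ.1.ne hxy.ne
      rcases hv with rfl | rfl <;> rcases hv' with h | h
      · exact h3 h
      · exact h1 h
      · exact h2 h.symm
      · exact h4 h)
  have hnsub : ¬ edgeImage H ψ ⊆ E ∪ edgeImage H φ := by
    intro hsub
    apply hsep
    constructor
    · intro h
      exact edgeImage_subset_of_glued hbal hreg hE hφ hψ hxy hout hsub hx'.ne' hx'y h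
        hy'x hy'.ne' hy'.symm
    · intro h
      exact edgeImage_subset_of_glued hbal hreg hE hφ hψ hxy hout hsub hy'x hy'.ne' h
        hx'.ne' hx'y hx'.symm
  refine ⟨ψ, hψ, ?_, hnsub⟩
  have key : ∀ {a b : V}, H.Adj a b → s(φ a, φ b) ∈ edgeImage H ψ →
      ∃ a b, H.Adj a b ∧ s(ψ a, ψ b) ∈ E ∪ edgeImage H φ ∧ ψ a ∈ Finset.univ.image φ ∧
        ψ b ∈ Finset.univ.image φ := by
    intro a b hab h
    obtain ⟨a', b', hab', h'⟩ := mem_edgeImage.mp h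
    refine ⟨a', b', hab', ?_, ?_⟩
    · rw [h']; exact Finset.mem_union_right _ (mk_mem_edgeImage hab)
    · rw [Sym2.eq_iff] at h'
      rcases h' with ⟨h1, h2⟩ | ⟨h1, h2⟩ <;> simp [h1, h2]
  by_cases h : s(φ x', φ x) ∈ edgeImage H ψ
  · exact key hx'.symm h
  · exact key hy'.symm (by tauto)

/-- `(W, E)` is a union of copies of `H` in `G`. -/
structure IsCopyUnion {V U : Type*} [Fintype V] (H : SimpleGraph V) (G : SimpleGraph U)
    (W : Finset U) (E : Finset (Sym2 U)) : Prop where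
  mem_verts : ∀ e ∈ E, ∀ z ∈ e, z ∈ W
  cover : ∀ w ∈ W, ∃ φ : V → U, IsCopyMap H G φ ∧ w ∈ Set.range φ ∧ edgeImage H φ ⊆ E
  subset : ∀ e ∈ E, e ∈ G.edgeSet

theorem IsCopyUnion.union {V U : Type*} [Fintype V] {H : SimpleGraph V} {G : SimpleGraph U}
    {W : Finset U} {E : Finset (Sym2 U)} (h : IsCopyUnion H G W E) {φ : V → U}
    (hφ : IsCopyMap H G φ) :
    IsCopyUnion H G (W ∪ Finset.univ.image φ) (E ∪ edgeImage H φ) where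
  mem_verts e he z hz := by
    rcases Finset.mem_union.mp he with he | he
    · exact Finset.mem_union_left _ (h.mem_verts e he z hz)
    · obtain ⟨a, b, -, rfl⟩ := mem_edgeImage.mp he
      rw [Sym2.mem_iff] at hz
      rcases hz with rfl | rfl <;> simp
  cover w hw := by
    rcases Finset.mem_union.mp hw with hw | hw
    · obtain ⟨ψ, h1, h2, h3⟩ := h.cover w hw
      exact ⟨ψ, h1, h2, h3.trans Finset.subset_union_left⟩
    · exact ⟨φ, hφ, by simpa using hw, Finset.subset_union_right⟩
  subset e he := by
    rcases Finset.mem_union.mp he with he | he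
    · exact h.subset e he
    · exact hφ.edge_mem he

/-- A union of copies of `H` that is closed in a minimal anti-Ramsey graph is dense. -/
theorem IsCopyUnion.dense_of_closed {V U : Type*} [Fintype V] [Fintype U] {H : SimpleGraph V}
    {G : SimpleGraph U} {d : ℕ} (hbal : StrictlyTwoBalanced H)
    (hreg : ∀ v : V, (H.neighborSet v).ncard = d) (hd : 2 ≤ d) (hv : 4 ≤ Fintype.card V)
    (hmin : Minimal (fun G : SimpleGraph U => AntiRamsey G H) G)
    {W : Finset U} {E : Finset (Sym2 U)} (hU : IsCopyUnion H G W E)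
    (hcl : ∀ ψ, IsCopyMap H G ψ → (∃ e ∈ edgeImage H ψ, e ∈ E) → edgeImage H ψ ⊆ E) :
    d * (d + 1) * W.card ≤ (2 * d + 1) * E.card := by
  obtain ⟨F, hF⟩ : ∃ F, F = SimpleGraph.fromEdgeSet (E : Set (Sym2 U)) := ⟨_, rfl⟩
  have hadj : ∀ a b, F.Adj a b ↔ s(a, b) ∈ E := by
    intro a b
    rw [hF, fromEdgeSet_adj]
    simp only [Finset.mem_coe, and_iff_left_iff_imp]
    intro h
    exact (show G.Adj a b from hU.subset _ h).ne
  have hncard : ∀ a, {w | s(a, w) ∈ E}.ncard = F.degree a := by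
    intro a
    rw [← SimpleGraph.card_neighborSet_eq_degree, ← Set.toFinset_card,
      ← Set.ncard_eq_toFinset_card']
    congr 1
    ext w
    simp [hadj]
  have hsum : ∑ v, F.degree v = 2 * E.card := by
    rw [F.sum_degrees_eq_twice_card_edges]
    congr 2
    ext e
    induction e with
    | h a b => exact Set.mem_toFinset.trans (hadj a b)
  have hdeg : ∀ w ∈ W, d ≤ F.degree w := by
    intro w hw
    obtain ⟨φ, hφ, ⟨z, rfl⟩, hsub⟩ := hU.cover w hw
    rw [← hncard, ← hreg z, ← Set.ncard_image_of_injective _ hφ.1]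
    refine Set.ncard_le_ncard ?_ (Set.toFinite _)
    rintro _ ⟨z', hz', rfl⟩
    exact hsub (mk_mem_edgeImage hz')
  have hmemW : ∀ {a b}, F.Adj a b → a ∈ W := fun {a b} hab =>
    hU.mem_verts _ ((hadj a b).mp hab) a (by simp)
  have hind : ∀ u w, F.Adj u w → F.degree u = d → F.degree w = d → False := by
    intro u w huw hdu hdw
    have through : ∀ u, F.degree u = d → ∀ ψ, IsCopyMap H G ψ → edgeImage H ψ ⊆ E →
        u ∈ Set.range ψ → ∀ w, F.Adj u w → s(u, w) ∈ edgeImage H ψ ∧ w ∈ Set.range ψ := by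
      rintro _ hdu ψ hψ hsub ⟨t, rfl⟩ w huw
      obtain ⟨t', ht', rfl⟩ := exists_adj_of_mem_of_ncard_le hreg hψ hsub (t := t)
        (by rw [hncard]; exact hdu.le) ((hadj _ _).mp huw)
      exact ⟨mk_mem_edgeImage ht', ⟨t', rfl⟩⟩
    obtain ⟨φ, hφ, ⟨x, rfl⟩, hsub⟩ := hU.cover u (hmemW huw)
    obtain ⟨y, hxy, rfl⟩ := hφ.exists_edge (through _ hdu φ hφ hsub ⟨x, rfl⟩ w huw).1
    obtain ⟨x', y', hx', hy', hx'y, hy'x, hne⟩ := hbal.exists_disjoint_nbrs hreg hd hv hxy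
    obtain ⟨ψ, hψ, hsep⟩ := exists_copy_separating hmin (e := s(φ x, φ x')) (f := s(φ y, φ y'))
      (hφ.2 hx') (by
        intro v hv hv'
        rw [Sym2.mem_iff] at hv hv'
        have h1 := hφ.1.ne hx'y
        have h2 := hφ.1.ne hy'x
        have h3 := hφ.1.ne hne
        have h4 := hφ.1.ne hxy.ne
        rcases hv with rfl | rfl <;> rcases hv' with h | h
        · exact h4 h
        · exact h2 h.symm
        · exact h1 h
        · exact h3 h)
    have hFx' : F.Adj (φ x) (φ x') := (hadj _ _).mpr (hsub (mk_mem_edgeImage hx'))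
    have hFy' : F.Adj (φ y) (φ y') := (hadj _ _).mpr (hsub (mk_mem_edgeImage hy'))
    have hrange : ∀ {a b : U}, s(a, b) ∈ edgeImage H ψ → a ∈ Set.range ψ := by
      intro a b hab
      obtain ⟨p, q, -, h⟩ := mem_edgeImage.mp hab
      rw [Sym2.eq_iff] at h
      rcases h with ⟨h, -⟩ | ⟨-, h⟩
      · exact ⟨p, h⟩
      · exact ⟨q, h⟩
    apply hsep
    constructor
    · intro h
      have hs := hcl ψ hψ ⟨_, h, (hadj _ _).mp hFx'⟩
      have hy := (through _ hdu ψ hψ hs (hrange h) _ huw).2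
      exact (through _ hdw ψ hψ hs hy _ hFy').1
    · intro h
      have hs := hcl ψ hψ ⟨_, h, (hadj _ _).mp hFy'⟩
      have hy := (through _ hdw ψ hψ hs (hrange h) _ huw.symm).2
      exact (through _ hdu ψ hψ hs hy _ hFx').1
  set A := W.filter (fun w => F.degree w = d) with hA
  set B := W.filter (fun w => ¬ F.degree w = d) with hB
  have hAB : A.card + B.card = W.card := Finset.card_filter_add_card_filter_not _
  have hsumW : ∑ w ∈ A, F.degree w + ∑ w ∈ B, F.degree w = 2 * E.card := by
    rw [Finset.sum_filter_add_sum_filter_not, ← hsum]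
    refine Finset.sum_subset (Finset.subset_univ _) fun w _ hw => ?_
    rw [← SimpleGraph.card_neighborFinset_eq_degree, Finset.card_eq_zero,
      Finset.eq_empty_iff_forall_notMem]
    intro b hb
    exact hw (hmemW (by simpa using hb))
  have hsumA : ∑ w ∈ A, F.degree w = d * A.card := by
    rw [Finset.sum_congr rfl (fun w hw => (Finset.mem_filter.mp hw).2)]
    rw [Finset.sum_const, smul_eq_mul, mul_comm]
  have hsumB : (d + 1) * B.card ≤ ∑ w ∈ B, F.degree w := by
    rw [mul_comm, ← smul_eq_mul]
    refine Finset.card_nsmul_le_sum _ _ _ fun w hw => ?_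
    have h := Finset.mem_filter.mp hw
    have := hdeg w h.1
    have := h.2
    omega
  have hdouble : d * A.card ≤ ∑ w ∈ B, F.degree w := by
    rw [← hsumA]
    have h := Finset.sum_card_bipartiteAbove_eq_sum_card_bipartiteBelow (s := A) (t := B) F.Adj
    calc ∑ w ∈ A, F.degree w ≤ ∑ w ∈ A, (Finset.bipartiteAbove F.Adj B w).card := by
          refine Finset.sum_le_sum fun a ha => ?_
          rw [← SimpleGraph.card_neighborFinset_eq_degree]
          refine Finset.card_le_card fun b hb => ?_
          have hab : F.Adj a b := by simpa using hb
          rw [Finset.mem_bipartiteAbove]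
          refine ⟨Finset.mem_filter.mpr ⟨hmemW hab.symm, fun hdb => ?_⟩, hab⟩
          exact hind a b hab (Finset.mem_filter.mp ha).2 hdb
      _ = ∑ b ∈ B, (Finset.bipartiteBelow F.Adj A b).card := h
      _ ≤ ∑ w ∈ B, F.degree w := by
          refine Finset.sum_le_sum fun b hb => ?_
          rw [← SimpleGraph.card_neighborFinset_eq_degree]
          refine Finset.card_le_card fun a ha => ?_
          rw [Finset.mem_bipartiteBelow] at ha
          simpa using ha.2.symm
  rw [hsumA] at hsumW
  set S := ∑ w ∈ B, F.degree w
  rw [← hAB]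
  nlinarith [Nat.mul_le_mul_left d hsumB]

/-- The exponent of the expected number of configurations of the type `(W, E)`, scaled to be an
integer. -/
noncomputable def potential {V U : Type*} [Fintype V] (H : SimpleGraph V) (W : Finset U)
    (E : Finset (Sym2 U)) : ℤ :=
  ((edgeFin H).card - 1) * W.card - (Fintype.card V - 2) * E.card

theorem card_union_image {V U : Type*} [Fintype V] {φ : V → U} (hφ : Function.Injective φ)
    (W : Finset U) :
    (W ∪ Finset.univ.image φ).card = W.card + (Finset.univ.filter (fun z => φ z ∉ W)).card := by
  have : W ∪ Finset.univ.image φ = W ∪ (Finset.univ.filter (fun z => φ z ∉ W)).image φ := by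
    ext u
    simp only [Finset.mem_union, Finset.mem_image, Finset.mem_univ, true_and, Finset.mem_filter]
    constructor
    · rintro (h | ⟨z, rfl⟩)
      · exact Or.inl h
      · by_cases h : φ z ∈ W
        · exact Or.inl h
        · exact Or.inr ⟨z, h, rfl⟩
    · rintro (h | ⟨z, -, rfl⟩)
      · exact Or.inl h
      · exact Or.inr ⟨z, rfl⟩
  rw [this, Finset.card_union_of_disjoint, Finset.card_image_of_injective _ hφ]
  rw [Finset.disjoint_left]
  intro u hu hu'
  simp only [Finset.mem_image, Finset.mem_filter, Finset.mem_univ, true_and] at hu'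
  obtain ⟨z, hz, rfl⟩ := hu'
  exact hz hu

theorem card_union_edgeImage {V U : Type*} [Fintype V] {H : SimpleGraph V} {φ : V → U}
    (hφ : Function.Injective φ) (E : Finset (Sym2 U)) :
    (E ∪ edgeImage H φ).card + ((edgeFin H).filter (fun e => Sym2.map φ e ∈ E)).card =
      E.card + (edgeFin H).card := by
  have h1 : (edgeFin H).card = (edgeImage H φ).card :=
    (Finset.card_image_of_injective _ (Sym2.map.injective hφ)).symm
  have h2 : ((edgeFin H).filter (fun e => Sym2.map φ e ∈ E)).card = (E ∩ edgeImage H φ).card := by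
    rw [← Finset.card_image_of_injective _ (Sym2.map.injective hφ)]
    congr 1
    ext e
    simp only [edgeImage, Finset.mem_image, Finset.mem_filter, Finset.mem_inter]
    constructor
    · rintro ⟨f, ⟨h, h'⟩, rfl⟩
      exact ⟨h', f, h, rfl⟩
    · rintro ⟨h', f, h, rfl⟩
      exact ⟨f, ⟨h, h'⟩, rfl⟩
  rw [h1, h2, Finset.card_union_add_card_inter]

/-- Adding a copy along a single edge preserves the potential, any other way of adding a copy
that shares an edge decreases it. -/
theorem potential_union {V U : Type*} [Fintype V] {H : SimpleGraph V}
    (hbal : StrictlyTwoBalanced H) (hv : 3 ≤ Fintype.card V)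
    {W : Finset U} {E : Finset (Sym2 U)} (hE : ∀ e ∈ E, ∀ z ∈ e, z ∈ W) {ψ : V → U}
    (hψ : Function.Injective ψ) (hnew : ¬ edgeImage H ψ ⊆ E) {a b : V} (hab : H.Adj a b)
    (habE : s(ψ a, ψ b) ∈ E) :
    potential H (W ∪ Finset.univ.image ψ) (E ∪ edgeImage H ψ) ≤ potential H W E - 1 ∨
      (potential H (W ∪ Finset.univ.image ψ) (E ∪ edgeImage H ψ) = potential H W E ∧
        ∀ z, z ≠ a → z ≠ b → ψ z ∉ W) := by
  have hV := card_union_image hψ W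
  have hEc := card_union_edgeImage (H := H) hψ E
  set S := Finset.univ.filter (fun z => ψ z ∈ W) with hS
  set T := (edgeFin H).filter (fun e => Sym2.map ψ e ∈ E) with hT
  have hS' : S.card + (Finset.univ.filter (fun z => ψ z ∉ W)).card = Fintype.card V := by
    rw [hS, Finset.card_filter_add_card_filter_not, Finset.card_univ]
  have hTS : ∀ e ∈ T, ∀ z ∈ e, z ∈ S := by
    intro e he z hz
    rw [hS, Finset.mem_filter]
    exact ⟨Finset.mem_univ _, hE _ (Finset.mem_filter.mp he).2 _ (Sym2.mem_map.mpr ⟨z, hz, rfl⟩)⟩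
  have habT : s(a, b) ∈ T := Finset.mem_filter.mpr ⟨mem_edgeFin.mpr hab, by simpa using habE⟩
  have haS := hTS _ habT a (by simp)
  have hbS := hTS _ habT b (by simp)
  have hab2 : ({a, b} : Finset V) ⊆ S := by
    intro z hz
    simp only [Finset.mem_insert, Finset.mem_singleton] at hz
    rcases hz with rfl | rfl <;> assumption
  have hpc : ({a, b} : Finset V).card = 2 := Finset.card_pair hab.ne
  have he1 : 1 ≤ (edgeFin H).card := Finset.card_pos.mpr ⟨s(a, b), mem_edgeFin.mpr hab⟩
  have hVz : ((W ∪ Finset.univ.image ψ).card : ℤ) = W.card + Fintype.card V - S.card := by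
    rw [hV, ← hS']; push_cast; ring
  have hEz : ((E ∪ edgeImage H ψ).card : ℤ) = E.card + (edgeFin H).card - T.card := by
    have : ((E ∪ edgeImage H ψ).card : ℤ) + T.card = E.card + (edgeFin H).card := by
      exact_mod_cast hEc
    linarith
  simp only [potential, hVz, hEz]
  by_cases h3 : 3 ≤ S.card
  · left
    have := hbal.sub_mul_lt hv he1 (Finset.filter_subset _ _) hTS (Or.inr fun h => by
      apply hnew
      intro e he
      obtain ⟨f, hf, rfl⟩ := Finset.mem_image.mp he
      rw [← h] at hf
      exact (Finset.mem_filter.mp hf).2) h3 (Finset.card_pos.mpr ⟨_, habT⟩)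
    nlinarith
  · right
    have hSe : S = {a, b} := (Finset.eq_of_subset_of_card_le hab2 (by omega)).symm
    have hTe : T = {s(a, b)} := by
      apply Finset.Subset.antisymm
      · intro e he
        have h1 := hTS e he
        have h2 := (Finset.mem_filter.mp he).1
        induction e with
        | h p q =>
          have hp := h1 p (by simp)
          have hq := h1 q (by simp)
          have hpq : p ≠ q := (mem_edgeFin.mp h2 : H.Adj p q).ne
          rw [hSe] at hp hq
          simp only [Finset.mem_insert, Finset.mem_singleton, Sym2.eq_iff] at hp hq ⊢
          rcases hp with rfl | rfl <;> rcases hq with rfl | rfl <;> simp_all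
      · simpa using habT
    refine ⟨?_, ?_⟩
    · rw [hSe, hTe, hpc, Finset.card_singleton]
      push_cast
      ring
    · intro z hza hzb hz
      have : z ∈ S := Finset.mem_filter.mpr ⟨Finset.mem_univ _, hz⟩
      rw [hSe] at this
      simp [hza, hzb] at this

/-- Starting from the configuration `(W, E)`, whose last copy of `H` lives on `O`, copies of `H` can
be added one by one until the potential is negative or `r` copies have been added. All but at most
`b` of the copies meet the configuration only in the copy added just before them. When the process
stops, the edges lie in `G` and the potential is small. -/
def Explores {V U : Type*} [Fintype V] (H : SimpleGraph V) (G : SimpleGraph U) :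
    ℕ → ℕ → Finset U → Finset (Sym2 U) → Finset U → Prop
  | 0, _, W, E, _ => (∀ e ∈ E, e ∈ G.edgeSet) ∧ potential H W E ≤ 4 * ((edgeFin H).card - 1)
  | r + 1, b, W, E, O =>
    ((∀ e ∈ E, e ∈ G.edgeSet) ∧ potential H W E < 0) ∨
    (∃ φ : V → U, (Function.Injective φ ∧ ¬ edgeImage H φ ⊆ E ∧ ∀ z, φ z ∈ W → φ z ∈ O) ∧
      Explores H G r b (W ∪ Finset.univ.image φ) (E ∪ edgeImage H φ) (Finset.univ.image φ)) ∨
    (b ≠ 0 ∧ ∃ φ : V → U, (Function.Injective φ ∧ ¬ edgeImage H φ ⊆ E ∧ ∀ z, φ z ∈ W → φ z ∈ W) ∧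
      Explores H G r (b - 1) (W ∪ Finset.univ.image φ) (E ∪ edgeImage H φ)
        (Finset.univ.image φ))

theorem IsCopyUnion.explores {V U : Type*} [Fintype V] [Fintype U] {H : SimpleGraph V}
    {G : SimpleGraph U} {d : ℕ} (hbal : StrictlyTwoBalanced H)
    (hreg : ∀ v : V, (H.neighborSet v).ncard = d) (hd : 2 ≤ d) (hv : 4 * d ≤ Fintype.card V)
    (hmin : Minimal (fun G : SimpleGraph U => AntiRamsey G H) G) (r : ℕ) :
    ∀ (b : ℕ) (W : Finset U) (E : Finset (Sym2 U)) (O : Finset U),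
      IsCopyUnion H G W E → W.Nonempty → b ≤ 4 * (edgeFin H).card →
      2 * potential H W E ≤ b + (if Extendable H G E O then 1 else 0) - 2 →
      Explores H G r b W E O := by
  have h2e := two_mul_card_edgeFin hreg
  have he2 : 8 ≤ (edgeFin H).card := by nlinarith
  induction r with
  | zero =>
    intro b W E O hU hW hb hpot
    refine ⟨hU.subset, ?_⟩
    have hb' : (b : ℤ) ≤ 4 * (edgeFin H).card := by exact_mod_cast hb
    have he2' : (8 : ℤ) ≤ (edgeFin H).card := by exact_mod_cast he2
    split_ifs at hpot <;> linarith
  | succ r ih =>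
    intro b W E O hU hW hb hpot
    by_cases hneg : potential H W E < 0
    · exact Or.inl ⟨hU.subset, hneg⟩
    have hb0 : b ≠ 0 := by
      rintro rfl
      push_cast at hpot
      split_ifs at hpot <;> omega
    have hb1 : ((b - 1 : ℕ) : ℤ) = (b : ℤ) - 1 := by omega
    have hite : ∀ (E : Finset (Sym2 U)) (O : Finset U),
        (0 : ℤ) ≤ (if Extendable H G E O then 1 else 0) ∧
          (if Extendable H G E O then (1 : ℤ) else 0) ≤ 1 := by
      intro E O
      split_ifs <;> norm_num
    have hdeg : ∀ ψ, IsCopyMap H G ψ → ¬ edgeImage H ψ ⊆ E →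
        potential H (W ∪ Finset.univ.image ψ) (E ∪ edgeImage H ψ) ≤ potential H W E - 1 →
        Explores H G (r + 1) b W E O := by
      intro ψ hψ hnew hp
      refine Or.inr (Or.inr ⟨hb0, ψ, ⟨hψ.1, hnew, fun _ h => h⟩, ?_⟩)
      refine ih _ _ _ _ (hU.union hψ) (hW.mono Finset.subset_union_left) (by omega) ?_
      have h1 := hite E O
      have h2 := hite (E ∪ edgeImage H ψ) (Finset.univ.image ψ)
      rw [hb1]
      linarith
    by_cases hext : Extendable H G E O
    · rw [if_pos hext] at hpot
      obtain ⟨ψ, hψ, ⟨x, y, hxy, hxyE, hxO, hyO⟩, hnew⟩ := hext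
      rcases potential_union hbal (by omega) hU.mem_verts hψ.1 hnew hxy hxyE with hp | ⟨hp, hout⟩
      · exact hdeg ψ hψ hnew hp
      · refine Or.inr (Or.inl ⟨ψ, ⟨hψ.1, hnew, ?_⟩, ?_⟩)
        · intro z hz
          by_cases hzx : z = x
          · rwa [hzx]
          by_cases hzy : z = y
          · rwa [hzy]
          exact absurd hz (hout z hzx hzy)
        · refine ih _ _ _ _ (hU.union hψ) (hW.mono Finset.subset_union_left) hb ?_
          rw [if_pos (extendable_of_glued hbal hreg hd (by omega) hmin hU.mem_verts hψ hxy hout),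
            hp]
          exact hpot
    · rw [if_neg hext] at hpot
      by_cases hcl : ∀ ψ, IsCopyMap H G ψ → (∃ e ∈ edgeImage H ψ, e ∈ E) → edgeImage H ψ ⊆ E
      · exfalso
        apply hneg
        have hdense := hU.dense_of_closed hbal hreg hd (by omega) hmin hcl
        have hWc := hW.card_pos
        zify at hdense hWc h2e hd hv
        rw [potential]
        have hkey : ((2 * d + 1 : ℤ)) * (2 * ((edgeFin H).card - 1)) <
            2 * (d * (d + 1)) * (Fintype.card V - 2) := by
          nlinarith
        have h1 : ((2 * d + 1 : ℤ)) * (2 * ((edgeFin H).card - 1)) * W.card <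
            2 * (d * (d + 1)) * (Fintype.card V - 2) * W.card :=
          mul_lt_mul_of_pos_right hkey hWc
        have h2 : (d * (d + 1) * W.card : ℤ) * (Fintype.card V - 2) ≤
            (2 * d + 1) * E.card * (Fintype.card V - 2) :=
          mul_le_mul_of_nonneg_right hdense (by linarith)
        have h3 : ((2 * d + 1 : ℤ)) * (((edgeFin H).card - 1) * W.card) <
            (2 * d + 1) * ((Fintype.card V - 2) * E.card) := by
          nlinarith
        have := lt_of_mul_lt_mul_left h3 (by linarith)
        linarith
      · push Not at hcl
        obtain ⟨ψ, hψ, ⟨e, heψ, heE⟩, hnew⟩ := hcl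
        obtain ⟨x, y, hxy, rfl⟩ := mem_edgeImage.mp heψ
        rcases potential_union hbal (by omega) hU.mem_verts hψ.1 hnew hxy heE with hp | ⟨hp, hout⟩
        · exact hdeg ψ hψ hnew hp
        · refine Or.inr (Or.inr ⟨hb0, ψ, ⟨hψ.1, hnew, fun _ h => h⟩, ?_⟩)
          refine ih _ _ _ _ (hU.union hψ) (hW.mono Finset.subset_union_left) (by omega) ?_
          rw [if_pos (extendable_of_glued hbal hreg hd (by omega) hmin hU.mem_verts hψ hxy hout),
            hp, hb1]
          linarith

theorem Explores.mono {V U : Type*} [Fintype V] {H : SimpleGraph V} {G G' : SimpleGraph U}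
    (hG : G ≤ G') (r : ℕ) : ∀ (b : ℕ) (W : Finset U) (E : Finset (Sym2 U)) (O : Finset U),
      Explores H G r b W E O → Explores H G' r b W E O := by
  have hsub := SimpleGraph.edgeSet_mono hG
  induction r with
  | zero =>
    rintro b W E O ⟨h1, h2⟩
    exact ⟨fun e he => hsub (h1 e he), h2⟩
  | succ r ih =>
    rintro b W E O (⟨h1, h2⟩ | ⟨φ, h, h'⟩ | ⟨hb, φ, h, h'⟩)
    · exact Or.inl ⟨fun e he => hsub (h1 e he), h2⟩
    · exact Or.inr (Or.inl ⟨φ, h, ih _ _ _ _ h'⟩)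
    · exact Or.inr (Or.inr ⟨hb, φ, h, ih _ _ _ _ h'⟩)

theorem AntiRamsey.exists_explores {V : Type*} {U : Type} [Fintype V] [Fintype U]
    {H : SimpleGraph V} {G : SimpleGraph U} {d : ℕ} (hbal : StrictlyTwoBalanced H)
    (hreg : ∀ v : V, (H.neighborSet v).ncard = d) (hd : 2 ≤ d) (hv : 4 * d ≤ Fintype.card V)
    (hG : AntiRamsey G H) (r : ℕ) :
    ∃ φ : V → U, Function.Injective φ ∧
      Explores H G r (4 * (edgeFin H).card) (Finset.univ.image φ) (edgeImage H φ)
        (Finset.univ.image φ) := by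
  obtain ⟨G', hle, hmin⟩ :=
    (Set.toFinite {G : SimpleGraph U | AntiRamsey G H}).exists_le_minimal hG
  have hmin : Minimal (fun G : SimpleGraph U => AntiRamsey G H) G' := hmin
  obtain ⟨φ', hφ', -⟩ := hmin.prop _ (id : Sym2 U → Sym2 U) (fun e _ e' _ hne _ => hne)
  set φ : V → U := fun x => φ' x
  have hφ : IsCopyMap H G' φ := ⟨φ'.injective, hφ'⟩
  refine ⟨φ, hφ.1, Explores.mono hle _ _ _ _ _ ?_⟩
  obtain ⟨x⟩ : Nonempty V := Fintype.card_pos_iff.mp (by omega)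
  obtain ⟨y, hxy⟩ : (H.neighborSet x).Nonempty := by
    rw [← Set.ncard_pos, hreg]; omega
  have h0 : IsCopyUnion H G' (∅ : Finset U) ∅ := ⟨by simp, by simp, by simp⟩
  have h1 := h0.union hφ
  have h2 := extendable_of_glued (W := ∅) (E := ∅) hbal hreg hd (by omega) hmin (by simp) hφ
    (show H.Adj x y from hxy) (by simp)
  rw [Finset.empty_union] at h2
  rw [Finset.empty_union, Finset.empty_union] at h1
  refine IsCopyUnion.explores hbal hreg hd hv hmin r _ _ _ _ h1 ⟨φ x, by simp⟩ le_rfl ?_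
  rw [if_pos h2, potential, Finset.card_image_of_injective _ hφ.1, edgeImage,
    Finset.card_image_of_injective _ (Sym2.map.injective hφ.1), Finset.card_univ]
  have h2e := two_mul_card_edgeFin hreg
  have hv' : (1 : ℤ) ≤ Fintype.card V := by exact_mod_cast (by omega : 1 ≤ Fintype.card V)
  push_cast
  nlinarith

theorem grProb_term_nonneg {n : ℕ} {p : ℝ} (h0 : 0 ≤ p) (h1 : p ≤ 1) (G : SimpleGraph (Fin n)) :
    0 ≤ p ^ G.edgeSet.ncard * (1 - p) ^ (n.choose 2 - G.edgeSet.ncard) :=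
  mul_nonneg (pow_nonneg h0 _) (pow_nonneg (by linarith) _)

theorem grProb_nonneg {n : ℕ} {p : ℝ} (h0 : 0 ≤ p) (h1 : p ≤ 1) (P : SimpleGraph (Fin n) → Prop) :
    0 ≤ grProb n p P := by
  refine Finset.sum_nonneg fun G _ => ?_
  split_ifs
  · exact grProb_term_nonneg h0 h1 G
  · exact le_rfl

theorem grProb_mono {n : ℕ} {p : ℝ} (h0 : 0 ≤ p) (h1 : p ≤ 1) {P Q : SimpleGraph (Fin n) → Prop}
    (hPQ : ∀ G, P G → Q G) : grProb n p P ≤ grProb n p Q := by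
  refine Finset.sum_le_sum fun G _ => ?_
  have := grProb_term_nonneg h0 h1 G
  have := hPQ G
  split_ifs <;> simp_all

theorem grProb_or_le {n : ℕ} {p : ℝ} (h0 : 0 ≤ p) (h1 : p ≤ 1) (P Q : SimpleGraph (Fin n) → Prop) :
    grProb n p (fun G => P G ∨ Q G) ≤ grProb n p P + grProb n p Q := by
  rw [grProb, grProb, grProb, ← Finset.sum_add_distrib]
  refine Finset.sum_le_sum fun G _ => ?_
  have := grProb_term_nonneg h0 h1 G
  by_cases hP : P G <;> by_cases hQ : Q G <;> simp [hP, hQ, this]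

theorem grProb_exists_le {n : ℕ} {p : ℝ} (h0 : 0 ≤ p) (h1 : p ≤ 1) {ι : Type*} (s : Finset ι)
    (P : ι → SimpleGraph (Fin n) → Prop) :
    grProb n p (fun G => ∃ i ∈ s, P i G) ≤ ∑ i ∈ s, grProb n p (P i) := by
  simp only [grProb]
  rw [Finset.sum_comm]
  refine Finset.sum_le_sum fun G _ => ?_
  have h := grProb_term_nonneg h0 h1 G
  have hterm : ∀ i ∈ s, 0 ≤
      if P i G then p ^ G.edgeSet.ncard * (1 - p) ^ (n.choose 2 - G.edgeSet.ncard) else 0 := by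
    intro i _
    split_ifs
    · exact h
    · exact le_rfl
  split_ifs with hex
  · obtain ⟨i, hi, hPi⟩ := hex
    refine le_trans ?_ (Finset.single_le_sum hterm hi)
    rw [if_pos hPi]
  · exact Finset.sum_nonneg hterm

theorem grProb_subset_le {n : ℕ} {p : ℝ} (h0 : 0 ≤ p) (h1 : p ≤ 1) (E : Finset (Sym2 (Fin n))) :
    grProb n p (fun G => ∀ e ∈ E, e ∈ G.edgeSet) ≤ p ^ E.card := by
  set Ω := edgeFin (⊤ : SimpleGraph (Fin n)) with hΩ
  have hΩc : Ω.card = n.choose 2 := by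
    have h := SimpleGraph.card_edgeFinset_top_eq_card_choose_two (V := Fin n)
    rw [Fintype.card_fin] at h
    rw [← h]
    congr 1
    ext e
    rw [mem_edgeFin, mem_edgeFinset]
  set S := Finset.univ.filter (fun G : SimpleGraph (Fin n) => ∀ e ∈ E, e ∈ G.edgeSet) with hS
  have hsum : grProb n p (fun G => ∀ e ∈ E, e ∈ G.edgeSet) =
      ∑ G ∈ S, p ^ G.edgeSet.ncard * (1 - p) ^ (n.choose 2 - G.edgeSet.ncard) := by
    rw [grProb, hS, Finset.sum_filter]
    refine Finset.sum_congr rfl fun G _ => ?_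
    congr
  rw [hsum]
  by_cases hE : E ⊆ Ω
  swap
  · have : S = ∅ := by
      rw [Finset.eq_empty_iff_forall_notMem]
      intro G hG
      apply hE
      intro e he
      exact mem_edgeFin.mpr
        (SimpleGraph.edgeSet_mono le_top ((Finset.mem_filter.mp hG).2 e he))
    rw [this, Finset.sum_empty]
    exact pow_nonneg h0 _
  have hinj : Set.InjOn (fun G => edgeFin G \ E) (S : Set (SimpleGraph (Fin n))) := by
    intro G hG G' hG' h
    have hG := (Finset.mem_filter.mp (Finset.mem_coe.mp hG)).2
    have hG' := (Finset.mem_filter.mp (Finset.mem_coe.mp hG')).2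
    rw [← SimpleGraph.edgeSet_inj]
    ext e
    by_cases he : e ∈ E
    · simp [hG e he, hG' e he]
    · have := congrArg (fun s => e ∈ s) h
      simpa [mem_edgeFin, he] using this
  calc ∑ G ∈ S, p ^ G.edgeSet.ncard * (1 - p) ^ (n.choose 2 - G.edgeSet.ncard)
      = ∑ G ∈ S, p ^ E.card * (p ^ (edgeFin G \ E).card *
          (1 - p) ^ ((Ω \ E).card - (edgeFin G \ E).card)) := by
        refine Finset.sum_congr rfl fun G hG => ?_
        have hG := (Finset.mem_filter.mp hG).2
        have hEG : E ⊆ edgeFin G := fun e he => mem_edgeFin.mpr (hG e he)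
        have e1 := Finset.card_sdiff_add_card_eq_card hEG
        have e2 := Finset.card_sdiff_add_card_eq_card hE
        rw [ncard_edgeSet_eq, ← hΩc, ← e1, ← e2, Nat.add_sub_add_right, pow_add]
        ring
    _ = ∑ T ∈ S.image (fun G => edgeFin G \ E), p ^ E.card * (p ^ T.card *
          (1 - p) ^ ((Ω \ E).card - T.card)) := by
        rw [Finset.sum_image hinj]
    _ ≤ ∑ T ∈ (Ω \ E).powerset, p ^ E.card * (p ^ T.card *
          (1 - p) ^ ((Ω \ E).card - T.card)) := by
        refine Finset.sum_le_sum_of_subset_of_nonneg ?_ fun T _ _ => ?_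
        · intro T hT
          obtain ⟨G, -, rfl⟩ := Finset.mem_image.mp hT
          rw [Finset.mem_powerset]
          refine Finset.sdiff_subset_sdiff (fun e he => ?_) le_rfl
          exact mem_edgeFin.mpr (SimpleGraph.edgeSet_mono le_top (mem_edgeFin.mp he))
        · exact mul_nonneg (pow_nonneg h0 _)
            (mul_nonneg (pow_nonneg h0 _) (pow_nonneg (by linarith) _))
    _ = p ^ E.card := by
        rw [← Finset.mul_sum, Finset.sum_pow_mul_eq_add_pow]
        simp

/-- The sum over one exploration step of the inverse of `n` to the number of new vertices. -/
theorem sum_step_le {V U : Type*} [Fintype V] [Fintype U] {n : ℕ} (hn : 0 < n)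
    (hU : Fintype.card U = n) (W O : Finset U) :
    ∑ φ ∈ Finset.univ.filter (fun φ : V → U => ∀ z, φ z ∈ W → φ z ∈ O),
      ((n : ℝ)⁻¹) ^ (Finset.univ.filter (fun z => φ z ∉ W)).card ≤
      ((O.card : ℝ) + 1) ^ Fintype.card V := by
  set g : U → ℝ := fun y => if y ∈ W then (if y ∈ O then 1 else 0) else (n : ℝ)⁻¹ with hg
  have hn' : (0 : ℝ) < n := by exact_mod_cast hn
  have hg0 : ∀ y, 0 ≤ g y := by
    intro y
    simp only [hg]
    split_ifs <;> positivity
  have hprod : ∀ φ : V → U, (∀ z, φ z ∈ W → φ z ∈ O) →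
      ∏ z, g (φ z) = ((n : ℝ)⁻¹) ^ (Finset.univ.filter (fun z => φ z ∉ W)).card := by
    intro φ hφ
    rw [← Finset.prod_const, Finset.prod_filter]
    refine Finset.prod_congr rfl fun z _ => ?_
    by_cases hz : φ z ∈ W
    · simp [hg, hz, hφ z hz]
    · simp [hg, hz]
  calc _ = ∑ φ ∈ Finset.univ.filter (fun φ : V → U => ∀ z, φ z ∈ W → φ z ∈ O),
        ∏ z, g (φ z) :=
        Finset.sum_congr rfl fun φ hφ => (hprod φ (Finset.mem_filter.mp hφ).2).symm
    _ ≤ ∑ φ : V → U, ∏ z, g (φ z) :=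
        Finset.sum_le_sum_of_subset_of_nonneg (Finset.filter_subset _ _)
          fun φ _ _ => Finset.prod_nonneg fun z _ => hg0 _
    _ = (∑ y, g y) ^ Fintype.card V := by
        have := Finset.prod_univ_sum (fun _ : V => (Finset.univ : Finset U))
          (fun _ y => g y)
        rw [Finset.prod_const, Finset.card_univ, Fintype.piFinset_univ] at this
        exact this.symm
    _ ≤ _ := by
        refine pow_le_pow_left₀ (Finset.sum_nonneg fun y _ => hg0 y) ?_ _
        have : ∀ y, g y ≤ (if y ∈ O then (1 : ℝ) else 0) + (n : ℝ)⁻¹ := by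
          intro y
          have : (0 : ℝ) ≤ (n : ℝ)⁻¹ := by positivity
          simp only [hg]
          split_ifs <;> linarith
        refine (Finset.sum_le_sum fun y _ => this y).trans ?_
        rw [Finset.sum_add_distrib]
        simp [hU, hn'.ne']

/-- The weight of a configuration: `|U| ^ (-|W|) * c ^ |E|`. -/
noncomputable def stateWeight {U : Type*} [Fintype U] (c : ℝ) (W : Finset U)
    (E : Finset (Sym2 U)) : ℝ :=
  ((Fintype.card U : ℝ)⁻¹) ^ W.card * c ^ E.card

theorem sum_stateWeight_le {V U : Type*} [Fintype V] [Fintype U] {H : SimpleGraph V} {n : ℕ}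
    (hn : 0 < n) (hU : Fintype.card U = n)
    {c : ℝ} (hc0 : 0 ≤ c) (hc1 : c ≤ 1) (W O : Finset U) (E : Finset (Sym2 U)) :
    ∑ φ ∈ Finset.univ.filter (fun φ : V → U =>
        Function.Injective φ ∧ ¬ edgeImage H φ ⊆ E ∧ ∀ z, φ z ∈ W → φ z ∈ O),
      stateWeight c (W ∪ Finset.univ.image φ) (E ∪ edgeImage H φ) ≤
      c * ((O.card : ℝ) + 1) ^ Fintype.card V * stateWeight c W E := by
  have hw : 0 ≤ stateWeight c W E := by unfold stateWeight; positivity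
  calc _ ≤ ∑ φ ∈ Finset.univ.filter (fun φ : V → U =>
        Function.Injective φ ∧ ¬ edgeImage H φ ⊆ E ∧ ∀ z, φ z ∈ W → φ z ∈ O),
        c * stateWeight c W E * ((n : ℝ)⁻¹) ^ (Finset.univ.filter (fun z => φ z ∉ W)).card := by
        refine Finset.sum_le_sum fun φ hφ => ?_
        obtain ⟨-, hinj, hnew, -⟩ := Finset.mem_filter.mp hφ
        have hlt : E.card + 1 ≤ (E ∪ edgeImage H φ).card := by
          refine Finset.card_lt_card ⟨Finset.subset_union_left, fun h => hnew ?_⟩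
          exact Finset.subset_union_right.trans h
        rw [stateWeight, hU, card_union_image hinj, pow_add]
        have := pow_le_pow_of_le_one hc0 hc1 hlt
        calc _ ≤ (n : ℝ)⁻¹ ^ W.card * (n : ℝ)⁻¹ ^
              (Finset.univ.filter (fun z => φ z ∉ W)).card * c ^ (E.card + 1) := by gcongr
          _ = _ := by rw [stateWeight, hU]; ring
    _ ≤ ∑ φ ∈ Finset.univ.filter (fun φ : V → U => ∀ z, φ z ∈ W → φ z ∈ O),
        c * stateWeight c W E * ((n : ℝ)⁻¹) ^ (Finset.univ.filter (fun z => φ z ∉ W)).card := by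
        refine Finset.sum_le_sum_of_subset_of_nonneg (fun φ hφ => ?_) fun φ _ _ => by positivity
        rw [Finset.mem_filter] at hφ ⊢
        exact ⟨hφ.1, hφ.2.2.2⟩
    _ ≤ c * stateWeight c W E * ((O.card : ℝ) + 1) ^ Fintype.card V := by
        rw [← Finset.mul_sum]
        exact mul_le_mul_of_nonneg_left (sum_step_le hn hU W O) (by positivity)
    _ = _ := by ring

/-- A configuration with small potential is unlikely, relative to its weight. -/
theorem pow_card_le_stateWeight_mul {U : Type*} [Fintype U] {N D : ℕ} {p c α : ℝ} (hp : 0 ≤ p)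
    (hc : 0 ≤ c) (hα : 1 ≤ α) (hαn : α ^ N = Fintype.card U) (hpα : p ≤ c * (α ^ D)⁻¹)
    {W : Finset U} {E : Finset (Sym2 U)} {k : ℤ} (hk : (N : ℤ) * W.card - D * E.card ≤ k) :
    p ^ E.card ≤ stateWeight c W E * α ^ k := by
  have hα0 : 0 < α := by linarith
  calc p ^ E.card ≤ (c * (α ^ D)⁻¹) ^ E.card := pow_le_pow_left₀ hp hpα _
    _ = c ^ E.card * α ^ (-((D : ℤ) * E.card)) := by
        rw [mul_pow, inv_pow, ← pow_mul, zpow_neg]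
        congr 2
    _ ≤ c ^ E.card * α ^ (-((N : ℤ) * W.card) + k) := by
        refine mul_le_mul_of_nonneg_left (zpow_le_zpow_right₀ hα (by linarith)) (by positivity)
    _ = _ := by
        rw [zpow_add₀ hα0.ne', zpow_neg, stateWeight, ← hαn, inv_pow, ← pow_mul]
        have : α ^ ((N : ℤ) * W.card) = α ^ (N * W.card) := by
          exact_mod_cast zpow_natCast α (N * W.card)
        rw [this]
        ring


theorem card_image_univ_le {V U : Type*} [Fintype V] (φ : V → U) :
    (Finset.univ.image φ).card ≤ Fintype.card V :=
  Finset.card_image_le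

theorem card_union_image_univ_le {V U : Type*} [Fintype V] (φ : V → U) (W : Finset U) :
    (W ∪ Finset.univ.image φ).card ≤ W.card + Fintype.card V :=
  (Finset.card_union_le _ _).trans (Nat.add_le_add_left (card_image_univ_le φ) _)

/-- Some new copy of `H`, meeting the configuration `(W, E)` only in `O`, can be added to it so that
the result can be explored further. -/
def ExploresNext {V U : Type*} [Fintype V] [Fintype U] (H : SimpleGraph V) (G : SimpleGraph U)
    (r b : ℕ) (W : Finset U) (E : Finset (Sym2 U)) (O : Finset U) : Prop :=
  ∃ φ ∈ Finset.univ.filter (fun φ : V → U =>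
      Function.Injective φ ∧ ¬ edgeImage H φ ⊆ E ∧ ∀ z, φ z ∈ W → φ z ∈ O),
    Explores H G r b (W ∪ Finset.univ.image φ) (E ∪ edgeImage H φ) (Finset.univ.image φ)

theorem explores_succ_iff {V U : Type*} [Fintype V] [Fintype U] {H : SimpleGraph V}
    {G : SimpleGraph U} {r b : ℕ} {W : Finset U} {E : Finset (Sym2 U)} {O : Finset U} :
    Explores H G (r + 1) b W E O ↔ ((∀ e ∈ E, e ∈ G.edgeSet) ∧ potential H W E < 0) ∨
      ExploresNext H G r b W E O ∨ (b ≠ 0 ∧ ExploresNext H G r (b - 1) W E W) := by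
  simp only [Explores, ExploresNext, Finset.mem_filter, Finset.mem_univ, true_and]

theorem grProb_subset_and_le {n : ℕ} {p : ℝ} (h0 : 0 ≤ p) (h1 : p ≤ 1) (E : Finset (Sym2 (Fin n)))
    {P : Prop} {x : ℝ} (hx : 0 ≤ x) (h : P → p ^ E.card ≤ x) :
    grProb n p (fun G => (∀ e ∈ E, e ∈ G.edgeSet) ∧ P) ≤ x := by
  by_cases hP : P
  · exact (grProb_mono h0 h1 fun G hG => hG.1).trans ((grProb_subset_le h0 h1 E).trans (h hP))
  · simpa [grProb, hP] using hx

/-- Up to the weight of the initial configuration, an upper bound for the probability of an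
exploration with at most `r` steps, at most `b` of which are exceptional, that sees at most `M`
vertices. -/
noncomputable def exploreBound (v M n : ℕ) (α : ℝ) (r b : ℕ) : ℝ :=
  (2 * ((M : ℝ) + 1) ^ v) ^ b * (4 * α⁻¹ + (1 / 2) ^ r * (n : ℝ) ^ 4)

theorem exploreBound_nonneg {v M n : ℕ} {α : ℝ} (hα : 0 ≤ α) (r b : ℕ) :
    0 ≤ exploreBound v M n α r b := by
  unfold exploreBound
  positivity

theorem pow_four_le_exploreBound {v M n : ℕ} {α : ℝ} (hα : 0 ≤ α) (b : ℕ) :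
    (n : ℝ) ^ 4 ≤ exploreBound v M n α 0 b := by
  have h1 : (1 : ℝ) ≤ 2 * ((M : ℝ) + 1) ^ v := by
    have : (1 : ℝ) ≤ ((M : ℝ) + 1) ^ v := one_le_pow₀ (by simp)
    linarith
  have h2 : (1 : ℝ) ≤ (2 * ((M : ℝ) + 1) ^ v) ^ b := one_le_pow₀ h1
  have h3 : 0 ≤ α⁻¹ := by positivity
  have h4 : (0 : ℝ) ≤ (n : ℝ) ^ 4 := by positivity
  unfold exploreBound
  nlinarith

theorem exploreBound_succ {v M n : ℕ} {α : ℝ} (hα : 0 ≤ α) (r b : ℕ) :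
    α⁻¹ + 1 / 8 * exploreBound v M n α r b +
      (if b ≠ 0 then 1 / 8 * ((M : ℝ) + 1) ^ v * exploreBound v M n α r (b - 1) else 0) ≤
      exploreBound v M n α (r + 1) b := by
  have h1 : (1 : ℝ) ≤ 2 * ((M : ℝ) + 1) ^ v := by
    have : (1 : ℝ) ≤ ((M : ℝ) + 1) ^ v := one_le_pow₀ (by simp)
    linarith
  have h2 : (1 : ℝ) ≤ (2 * ((M : ℝ) + 1) ^ v) ^ b := one_le_pow₀ h1
  have h3 : 0 ≤ α⁻¹ := by positivity
  have h4 : (0 : ℝ) ≤ (1 / 2) ^ r * (n : ℝ) ^ 4 := by positivity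
  have h5 : (if b ≠ 0 then 1 / 8 * ((M : ℝ) + 1) ^ v * exploreBound v M n α r (b - 1) else 0) ≤
      1 / 16 * exploreBound v M n α r b := by
    split_ifs with hb
    · obtain ⟨b, rfl⟩ := Nat.exists_eq_succ_of_ne_zero hb
      rw [Nat.succ_sub_one]
      unfold exploreBound
      rw [Nat.succ_eq_add_one, pow_succ]
      exact le_of_eq (by ring)
    · have := exploreBound_nonneg (v := v) (M := M) (n := n) hα r b
      linarith
  refine (add_le_add_right h5 _).trans ?_
  unfold exploreBound
  rw [pow_succ (1 / 2 : ℝ)]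
  set K := (2 * ((M : ℝ) + 1) ^ v) ^ b
  set X := (1 / 2 : ℝ) ^ r * (n : ℝ) ^ 4 with hX
  have h6 : (1 / 2 : ℝ) ^ r * (1 / 2) * (n : ℝ) ^ 4 = X / 2 := by rw [hX]; ring
  rw [h6]
  nlinarith [mul_nonneg (sub_nonneg.mpr h2) h3, mul_nonneg (zero_le_one.trans h2) h4]

theorem grProb_explores_le {V : Type*} [Fintype V] {H : SimpleGraph V} {n M : ℕ} {p c α : ℝ}
    (hn : 0 < n) (hp0 : 0 ≤ p) (hp1 : p ≤ 1) (hc0 : 0 ≤ c)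
    (hc : c * ((Fintype.card V : ℝ) + 1) ^ Fintype.card V ≤ 1 / 8) (hα : 1 ≤ α)
    (he : 1 ≤ (edgeFin H).card) (hv : 2 ≤ Fintype.card V)
    (hαn : α ^ ((edgeFin H).card - 1) = n) (hpα : p ≤ c * (α ^ (Fintype.card V - 2))⁻¹) (r : ℕ) :
    ∀ (b : ℕ) (W : Finset (Fin n)) (E : Finset (Sym2 (Fin n))) (O : Finset (Fin n)),
      O.card ≤ Fintype.card V → W.card + Fintype.card V * r ≤ M →
      grProb n p (fun G => Explores H G r b W E O) ≤
        stateWeight c W E * exploreBound (Fintype.card V) M n α r b := by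
  have hα0 : 0 ≤ α := by linarith
  have hc8 : c ≤ 1 / 8 := by
    have : (1 : ℝ) ≤ ((Fintype.card V : ℝ) + 1) ^ Fintype.card V := one_le_pow₀ (by simp)
    nlinarith
  have hw : ∀ (W : Finset (Fin n)) (E : Finset (Sym2 (Fin n))), 0 ≤ stateWeight c W E := by
    intro W E
    unfold stateWeight
    positivity
  have hαn' : α ^ ((edgeFin H).card - 1) = Fintype.card (Fin n) := by rw [hαn, Fintype.card_fin]
  have hpot : ∀ {W : Finset (Fin n)} {E : Finset (Sym2 (Fin n))} {k : ℤ}, potential H W E ≤ k →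
      p ^ E.card ≤ stateWeight c W E * α ^ k := by
    intro W E k hk
    refine pow_card_le_stateWeight_mul hp0 hc0 hα hαn' hpα ?_
    rw [Nat.cast_sub he, Nat.cast_sub hv]
    simpa only [potential, Nat.cast_one, Nat.cast_ofNat] using hk
  induction r with
  | zero =>
    intro b W E O _ _
    simp only [Explores]
    refine grProb_subset_and_le hp0 hp1 E
      (mul_nonneg (hw W E) (exploreBound_nonneg hα0 _ _)) fun h => ?_
    refine (hpot h).trans (mul_le_mul_of_nonneg_left ?_ (hw W E))
    refine le_trans (le_of_eq ?_) (pow_four_le_exploreBound hα0 b)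
    rw [← hαn, ← pow_mul, ← zpow_natCast]
    congr 1
    push_cast [Nat.cast_sub he]
    ring
  | succ r ih =>
    intro b W E O hO hW
    have hstep : ∀ (b' : ℕ) (O' : Finset (Fin n)),
        grProb n p (fun G => ExploresNext H G r b' W E O') ≤
          c * ((O'.card : ℝ) + 1) ^ Fintype.card V * stateWeight c W E *
            exploreBound (Fintype.card V) M n α r b' := by
      intro b' O'
      refine (grProb_exists_le hp0 hp1 _ _).trans ?_
      refine (Finset.sum_le_sum fun φ _ => ih b' _ _ _ ?_ ?_).trans ?_
      · exact card_image_univ_le φ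
      · have := card_union_image_univ_le φ W
        rw [Nat.mul_succ] at hW
        omega
      · rw [← Finset.sum_mul]
        refine mul_le_mul_of_nonneg_right ?_ (exploreBound_nonneg hα0 _ _)
        exact sum_stateWeight_le hn (Fintype.card_fin n) hc0 (by linarith) W O' E
    have hbad : grProb n p (fun G => (∀ e ∈ E, e ∈ G.edgeSet) ∧ potential H W E < 0) ≤
        stateWeight c W E * α⁻¹ := by
      refine grProb_subset_and_le hp0 hp1 E (mul_nonneg (hw W E) (inv_nonneg.mpr hα0)) fun h => ?_
      rw [← zpow_neg_one]
      exact hpot (by omega)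
    have hlocal : grProb n p (fun G => ExploresNext H G r b W E O) ≤
        stateWeight c W E * (1 / 8 * exploreBound (Fintype.card V) M n α r b) := by
      refine (hstep b O).trans ?_
      have h1 : c * ((O.card : ℝ) + 1) ^ Fintype.card V ≤ 1 / 8 := by
        refine le_trans ?_ hc
        gcongr
      calc _ ≤ 1 / 8 * stateWeight c W E * exploreBound (Fintype.card V) M n α r b :=
            mul_le_mul_of_nonneg_right (mul_le_mul_of_nonneg_right h1 (hw W E))
              (exploreBound_nonneg hα0 _ _)
        _ = _ := by ring
    have hglobal : grProb n p (fun G => b ≠ 0 ∧ ExploresNext H G r (b - 1) W E W) ≤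
        stateWeight c W E * (if b ≠ 0 then 1 / 8 * ((M : ℝ) + 1) ^ Fintype.card V *
          exploreBound (Fintype.card V) M n α r (b - 1) else 0) := by
      by_cases hb : b = 0
      · simp [hb, grProb]
      · rw [if_pos hb]
        refine (grProb_mono hp0 hp1 fun G hG => hG.2).trans ((hstep (b - 1) W).trans ?_)
        have h1 : c * ((W.card : ℝ) + 1) ^ Fintype.card V ≤
            1 / 8 * ((M : ℝ) + 1) ^ Fintype.card V := by
          have : W.card ≤ M := by omega
          gcongr
        calc _ ≤ 1 / 8 * ((M : ℝ) + 1) ^ Fintype.card V * stateWeight c W E *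
              exploreBound (Fintype.card V) M n α r (b - 1) :=
            mul_le_mul_of_nonneg_right (mul_le_mul_of_nonneg_right h1 (hw W E))
              (exploreBound_nonneg hα0 _ _)
          _ = _ := by ring
    simp only [explores_succ_iff]
    refine (grProb_or_le hp0 hp1 _ _).trans ?_
    refine (add_le_add hbad ((grProb_or_le hp0 hp1 _ _).trans (add_le_add hlocal hglobal))).trans ?_
    rw [← mul_add, ← mul_add, ← add_assoc]
    exact mul_le_mul_of_nonneg_left (exploreBound_succ hα0 r b) (hw W E)

theorem AntiRamsey.explores_empty {V : Type*} {U : Type} [Fintype V] [Fintype U]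
    {H : SimpleGraph V} {G : SimpleGraph U} {d : ℕ} (hbal : StrictlyTwoBalanced H)
    (hreg : ∀ v : V, (H.neighborSet v).ncard = d) (hd : 2 ≤ d) (hv : 4 * d ≤ Fintype.card V)
    (he : 1 ≤ (edgeFin H).card) (hG : AntiRamsey G H) (r : ℕ) :
    Explores H G (r + 1) (4 * (edgeFin H).card) ∅ ∅ ∅ := by
  obtain ⟨φ, hφ, h⟩ := hG.exists_explores hbal hreg hd hv r
  refine Or.inr (Or.inl ⟨φ, ⟨hφ, ?_, by simp⟩, by simpa using h⟩)
  rw [Finset.subset_empty, edgeImage, Finset.image_eq_empty, ← Finset.card_eq_zero]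
  omega

theorem exploreBound_le {v N n : ℕ} {α : ℝ} (hn : 0 < n) (hN : 1 ≤ N) (hα : 1 ≤ α)
    (hαn : α ^ N = n) {r M : ℕ} (hr : n ^ 5 ≤ 2 ^ r) (b : ℕ) :
    exploreBound v M n α r b ≤ 5 * (2 * ((M : ℝ) + 1) ^ v) ^ b * α⁻¹ := by
  have hn' : (0 : ℝ) < n := by exact_mod_cast hn
  have hα0 : 0 < α := by linarith
  have h1 : (1 / 2 : ℝ) ^ r * (n : ℝ) ^ 4 ≤ α⁻¹ := by
    have h2 : (n : ℝ) ^ 5 ≤ 2 ^ r := by exact_mod_cast hr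
    have h3 : α ≤ n := by
      rw [← hαn]
      exact le_self_pow₀ hα (by omega)
    calc (1 / 2 : ℝ) ^ r * (n : ℝ) ^ 4 = (2 ^ r)⁻¹ * (n : ℝ) ^ 4 := by rw [one_div, inv_pow]
      _ ≤ ((n : ℝ) ^ 5)⁻¹ * (n : ℝ) ^ 4 := by gcongr
      _ = (n : ℝ)⁻¹ := by field_simp
      _ ≤ α⁻¹ := by gcongr
  have h4 : (0 : ℝ) ≤ (2 * ((M : ℝ) + 1) ^ v) ^ b := by positivity
  calc exploreBound v M n α r b ≤ (2 * ((M : ℝ) + 1) ^ v) ^ b * (4 * α⁻¹ + α⁻¹) :=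
        mul_le_mul_of_nonneg_left (by linarith) h4
    _ = _ := by ring

theorem Nat.tendsto_log_two_atTop : Tendsto (fun n : ℕ => Nat.log 2 n) atTop atTop := by
  refine tendsto_atTop.mpr fun b => ?_
  filter_upwards [eventually_ge_atTop (2 ^ b)] with n hn
  exact Nat.le_log_of_pow_le (by norm_num) hn

theorem tendsto_explore_error (v N b : ℕ) (hN : 1 ≤ N) :
    Tendsto (fun n : ℕ => 5 * (2 * (((v * (5 * (Nat.log 2 n + 1) + 1) : ℕ) : ℝ) + 1) ^ v) ^ b *
      ((n : ℝ) ^ (1 / (N : ℝ)))⁻¹) atTop (nhds 0) := by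
  set ρ : ℝ := ((2 : ℝ) ^ (1 / (N : ℝ)))⁻¹ with hρ
  have hN' : (0 : ℝ) < 1 / N := by
    have : (0 : ℝ) < N := by exact_mod_cast hN
    positivity
  have h2 : (1 : ℝ) < (2 : ℝ) ^ (1 / (N : ℝ)) := Real.one_lt_rpow (by norm_num) hN'
  have hρ0 : 0 < ρ := by positivity
  have hρ1 : |ρ| < 1 := by
    rw [abs_of_pos hρ0]
    exact inv_lt_one_of_one_lt₀ h2
  have hlim : Tendsto (fun n : ℕ => 5 * (2 * (11 * (v : ℝ) + 1) ^ v) ^ b *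
      (((Nat.log 2 n : ℕ) : ℝ) ^ (v * b) * ρ ^ Nat.log 2 n)) atTop (nhds 0) := by
    have := ((tendsto_pow_const_mul_const_pow_of_abs_lt_one (v * b) hρ1).comp
      Nat.tendsto_log_two_atTop).const_mul (5 * (2 * (11 * (v : ℝ) + 1) ^ v) ^ b)
    simpa using this
  refine squeeze_zero' (Eventually.of_forall fun n => by positivity) ?_ hlim
  filter_upwards [eventually_ge_atTop 2] with n hn
  set m := Nat.log 2 n with hm
  have hm1 : 1 ≤ m := Nat.le_log_of_pow_le (by norm_num) (by simpa using hn)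
  have hm1' : (1 : ℝ) ≤ m := by exact_mod_cast hm1
  have hb : ((v * (5 * (m + 1) + 1) : ℕ) : ℝ) + 1 ≤ (11 * (v : ℝ) + 1) * m := by
    push_cast
    have : (0 : ℝ) ≤ v := by positivity
    nlinarith
  have hn' : (2 : ℝ) ^ m ≤ n := by exact_mod_cast Nat.pow_log_le_self 2 (by omega)
  have hα : ((n : ℝ) ^ (1 / (N : ℝ)))⁻¹ ≤ ρ ^ m := by
    rw [hρ, inv_pow]
    refine inv_anti₀ (by positivity) ?_
    calc ((2 : ℝ) ^ (1 / (N : ℝ))) ^ m = ((2 : ℝ) ^ m) ^ (1 / (N : ℝ)) := by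
          rw [← Real.rpow_natCast, ← Real.rpow_natCast, ← Real.rpow_mul (by norm_num),
            ← Real.rpow_mul (by norm_num), mul_comm]
      _ ≤ _ := Real.rpow_le_rpow (by positivity) hn' hN'.le
  calc _ ≤ 5 * (2 * ((11 * (v : ℝ) + 1) * m) ^ v) ^ b * ρ ^ m := by gcongr
    _ = _ := by
      rw [mul_pow _ (m : ℝ) v, ← mul_assoc 2, mul_pow _ ((m : ℝ) ^ v) b, ← pow_mul]
      ring

end AntiRamseyZero

/-- the anti-Ramsey 0-statement for `d`-regular strictly 2-balanced graphs
on at least `4d` vertices. -/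
theorem stmt_9 {V : Type} [Fintype V] (H : SimpleGraph V) (d : ℕ) (hd : 1 ≤ d)
    (hreg : ∀ v : V, (H.neighborSet v).ncard = d)
    (hbal : StrictlyTwoBalanced H) (hcard : 4 * d ≤ Fintype.card V) :
    ∃ c : ℝ, 0 < c ∧ ∀ p : ℕ → ℝ, (∀ n, 0 ≤ p n ∧ p n ≤ 1) →
      (∀ n : ℕ, p n ≤ c * (n : ℝ) ^ (-(1 / twoDensity H))) →
      Tendsto (fun n => grProb n (p n) (fun G => AntiRamsey G H)) atTop (nhds 0) := by
  classical
  have hv4 : 4 ≤ Fintype.card V := by omega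
  have hd2 : 2 ≤ d := hbal.two_le_degree hreg hd (by omega)
  have h2e := two_mul_card_edgeFin hreg
  have he : 2 ≤ (edgeFin H).card := by nlinarith
  set v := Fintype.card V with hv
  set N := (edgeFin H).card - 1 with hN
  have hN1 : 1 ≤ N := by omega
  have hNr : (0 : ℝ) < N := by exact_mod_cast hN1
  set K : ℝ := ((v : ℝ) + 1) ^ v with hK
  have hK0 : 0 < K := by positivity
  refine ⟨1 / (8 * K), by positivity, fun p hp hpc => ?_⟩
  refine squeeze_zero' (Eventually.of_forall fun n => grProb_nonneg (hp n).1 (hp n).2 _) ?_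
    (tendsto_explore_error v N (4 * (edgeFin H).card) hN1)
  filter_upwards [eventually_ge_atTop 1] with n hn
  have hn1 : (1 : ℝ) ≤ n := by exact_mod_cast hn
  have hα1 : (1 : ℝ) ≤ (n : ℝ) ^ (1 / (N : ℝ)) := Real.one_le_rpow hn1 (by positivity)
  have hαn : ((n : ℝ) ^ (1 / (N : ℝ))) ^ N = n := by
    rw [one_div]
    exact Real.rpow_inv_natCast_pow (by linarith) (by omega)
  have hpα : p n ≤ 1 / (8 * K) * (((n : ℝ) ^ (1 / (N : ℝ))) ^ (v - 2))⁻¹ := by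
    refine (hpc n).trans (le_of_eq ?_)
    rw [twoDensity_eq hbal (by omega) (by omega), ← Real.rpow_natCast,
      ← Real.rpow_mul (by linarith), ← Real.rpow_neg (by linarith), hN,
      Nat.cast_sub (by omega), Nat.cast_sub (by omega), one_div_div, one_div_mul_eq_div _ (_ - _)]
    simp [hv]
  have hr : n ^ 5 ≤ 2 ^ (5 * (Nat.log 2 n + 1)) := by
    rw [mul_comm, pow_mul]
    exact Nat.pow_le_pow_left (Nat.lt_pow_succ_log_self (by norm_num) n).le 5
  refine le_trans ?_ (exploreBound_le hn hN1 hα1 hαn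
    (hr.trans (Nat.pow_le_pow_right (by norm_num) (Nat.le_succ _))) _)
  refine (grProb_mono (hp n).1 (hp n).2 fun G hG =>
    AntiRamsey.explores_empty hbal hreg hd2 hcard (by omega) hG (5 * (Nat.log 2 n + 1))).trans ?_
  have h := grProb_explores_le (M := v * (5 * (Nat.log 2 n + 1) + 1)) hn (hp n).1 (hp n).2
    (c := 1 / (8 * K)) (by positivity) (le_of_eq (by rw [← hv, ← hK]; field_simp)) hα1
    (by omega) (by omega) hαn hpα (5 * (Nat.log 2 n + 1) + 1) (4 * (edgeFin H).card) ∅ ∅ ∅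
    (by simp) (by simp [hv])
  simpa [stateWeight] using h
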